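/- arXiv:2602.18235 — 6 statements merged into one kernel-verified Lean document; each statement's English description precedes it below -/
import Mathlib

section
/- For any positive integers c and g, there exist a finite set P of points in ℝ² and a finite family 𝓡 of axis-parallel rectangles such that every R ∈ 𝓡 contains exactly two points of P, and the incidence graph on P (where distinct p, q are adjacent iff some R ∈ 𝓡 satisfies P ∩ R = {p, q}) has girth at least g and chromatic number at least c + 1. -/
/-- The axis-parallel rectangle `[x₁,x₂] × [y₁,y₂]` encoded by the quadruple
`(x₁, x₂, y₁, y₂)`. -/
def rectSet (r : ℝ × ℝ × ℝ × ℝ) : Set (ℝ × ℝ) :=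
  Set.Icc r.1 r.2.1 ×ˢ Set.Icc r.2.2.1 r.2.2.2

namespace RectGirth

open Finset Classical

/-- The set of vertices covered by a set of (indexed) hyperedges. -/
noncomputable def cov {V E ι : Type} [Fintype V] (inc : E → ι → V) (S : Finset E) : Finset V :=
  univ.filter (fun v => ∃ e ∈ S, ∃ i, inc e i = v)

/-- Every nonempty set of at most `k` hyperedges is a hyperforest. -/
def Sparse {V E ι : Type} [Fintype V] [Fintype ι] (k : ℕ) (inc : E → ι → V) : Prop :=
  ∀ S : Finset E, S.Nonempty → S.card ≤ k →
    Fintype.card ι * S.card + 1 ≤ (cov inc S).card + S.card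

theorem mem_cov {V E ι : Type} [Fintype V] (inc : E → ι → V) (S : Finset E) (v : V) :
    v ∈ cov inc S ↔ ∃ e ∈ S, ∃ i, inc e i = v := by simp [cov]

theorem Sparse.mono {V E ι : Type} [Fintype V] [Fintype ι] {k l : ℕ} {inc : E → ι → V}
    (h : Sparse l inc) (hk : k ≤ l) : Sparse k inc := fun S hS hc => h S hS (hc.trans hk)

theorem Sparse.map {V V' E ι : Type} [Fintype V] [Fintype V'] [Fintype ι] {k : ℕ}
    {inc : E → ι → V} (h : Sparse k inc) (f : V → V') (hf : Function.Injective f) :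
    Sparse k (fun e i => f (inc e i)) := by
  intro S hS hc
  have : cov (fun e i => f (inc e i)) S = (cov inc S).image f := by
    ext v; simp only [mem_cov, mem_image]
    constructor
    · rintro ⟨e, he, i, rfl⟩; exact ⟨_, ⟨e, he, i, rfl⟩, rfl⟩
    · rintro ⟨_, ⟨e, he, i, rfl⟩, rfl⟩; exact ⟨e, he, i, rfl⟩
  rw [this, card_image_of_injective _ hf]
  exact h S hS hc

theorem Sparse.reindex {V E ι : Type} {ι' : Type} [Fintype V] [Fintype ι] [Fintype ι'] {k : ℕ}
    {inc : E → ι → V} (h : Sparse k inc) (σ : E → ι' ≃ ι) :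
    Sparse k (fun e i => inc e (σ e i)) := by
  intro S hS hc
  have : cov (fun e i => inc e (σ e i)) S = cov inc S := by
    ext v; simp only [mem_cov]
    constructor
    · rintro ⟨e, he, i, rfl⟩; exact ⟨e, he, _, rfl⟩
    · rintro ⟨e, he, i, rfl⟩; exact ⟨e, he, (σ e).symm i, by simp⟩
  rw [this, Fintype.card_congr (σ hS.choose)]
  exact h S hS hc

theorem Sparse.inj {V E ι : Type} [Fintype V] [Fintype ι] {k : ℕ}
    {inc : E → ι → V} (h : Sparse k inc) (hk : 1 ≤ k) (e : E) : Function.Injective (inc e) := by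
  have h1 := h {e} (by simp) (by simpa using hk)
  have h2 : cov inc {e} = univ.image (inc e) := by
    ext v; simp [mem_cov]
  rw [h2] at h1
  simp only [card_singleton] at h1
  have h3 : (univ.image (inc e)).card = (univ : Finset ι).card :=
    le_antisymm card_image_le (by rw [card_univ]; omega)
  have := card_image_iff.1 h3
  intro a b hab
  exact this (by simp) (by simp) hab

/-- Partial traces on few hyperedges still form a hyperforest. -/
theorem trace_count {A D W : Type} [Fintype A] [Fintype W] {k : ℕ} {incF : D → A → W}
    (h : Sparse k incF) (D1 : Finset D) (hne : D1.Nonempty) (T : D → Finset A)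
    (hk : (D1.filter (fun d => 2 ≤ (T d).card)).card ≤ k) :
    ∑ d ∈ D1, (T d).card + 1 ≤ (D1.biUnion (fun d => (T d).image (incF d))).card + D1.card := by
  set D2 := D1.filter (fun d => 2 ≤ (T d).card) with hD2
  set D3 := D1.filter (fun d => ¬ 2 ≤ (T d).card) with hD3
  have hsum : ∑ d ∈ D1, (T d).card = ∑ d ∈ D2, (T d).card + ∑ d ∈ D3, (T d).card :=
    (sum_filter_add_sum_filter_not _ _ _).symm
  have hcard : D1.card = D2.card + D3.card := (card_filter_add_card_filter_not _).symm
  have hD3s : ∑ d ∈ D3, (T d).card ≤ D3.card := by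
    rw [card_eq_sum_ones]
    apply sum_le_sum
    intro d hd
    have := (mem_filter.1 hd).2
    omega
  by_cases h2 : D2.Nonempty
  · have hF := h D2 h2 hk
    have hsub : cov incF D2 ⊆ (D1.biUnion (fun d => (T d).image (incF d))) ∪
        D2.biUnion (fun d => (T d)ᶜ.image (incF d)) := by
      intro w hw
      obtain ⟨d, hd, a, rfl⟩ := (mem_cov _ _ _).1 hw
      rw [mem_union]
      by_cases ha : a ∈ T d
      · left
        exact mem_biUnion.2 ⟨d, (mem_filter.1 hd).1, mem_image_of_mem _ ha⟩
      · right
        exact mem_biUnion.2 ⟨d, hd, mem_image_of_mem _ (by simpa using ha)⟩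
    have h3 := (card_le_card hsub).trans (card_union_le _ _)
    have h4 : (D2.biUnion (fun d => (T d)ᶜ.image (incF d))).card ≤ ∑ d ∈ D2, (T d)ᶜ.card :=
      card_biUnion_le.trans (sum_le_sum fun d _ => card_image_le)
    have h5 : ∑ d ∈ D2, (T d)ᶜ.card + ∑ d ∈ D2, (T d).card = Fintype.card A * D2.card := by
      rw [← sum_add_distrib, mul_comm, ← smul_eq_mul, ← sum_const]
      apply sum_congr rfl
      intro d _
      rw [add_comm]
      exact card_add_card_compl _
    omega
  · have h2' : D2 = ∅ := not_nonempty_iff_eq_empty.1 h2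
    rw [h2'] at hsum hcard
    simp only [sum_empty, card_empty, zero_add] at hsum hcard
    by_cases hT : ∃ d ∈ D1, (T d).Nonempty
    · obtain ⟨d, hd, a, ha⟩ := hT
      have : 0 < (D1.biUnion (fun d => (T d).image (incF d))).card :=
        card_pos.2 ⟨incF d a, mem_biUnion.2 ⟨d, hd, mem_image_of_mem _ ha⟩⟩
      omega
    · push Not at hT
      have : ∑ d ∈ D1, (T d).card = 0 := sum_eq_zero fun d hd => by
        rw [hT d hd]; simp
      have := hne.card_pos
      omega

/-- Amalgamation: one copy of the system on `A ⊕ B` per hyperedge `d`, glued along `A`. -/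
def amInc {A B D E W ι : Type} (inc : E → ι → A ⊕ B) (incF : D → A → W) :
    D × E → ι → W ⊕ (D × B) :=
  fun de i => Sum.map (incF de.1) (Prod.mk de.1) (inc de.2 i)

theorem amalgam_sparse {A B D E W ι : Type} [Fintype A] [Fintype B] [Fintype D] [Fintype W]
    [Fintype ι] {g k : ℕ} {inc : E → ι → A ⊕ B} {incF : D → A → W}
    (hX : Sparse g inc) (hF : Sparse k incF) (hgk : g < 2 * k + 2)
    (hA : ∀ e i j a b, inc e i = Sum.inl a → inc e j = Sum.inl b → a = b) :
    Sparse g (amInc inc incF) := by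
  intro S hS hSg
  set D1 : Finset D := S.image Prod.fst with hD1
  have hD1ne : D1.Nonempty := hS.image _
  set Sd : D → Finset E := fun d => (S.filter (fun x => x.1 = d)).image Prod.snd with hSd
  have mem_Sd : ∀ d e, e ∈ Sd d ↔ (d, e) ∈ S := by
    intro d e; simp [hSd]
  have cardSd : ∀ d, (Sd d).card = (S.filter (fun x => x.1 = d)).card := by
    intro d
    apply card_image_of_injOn
    rintro ⟨a, b⟩ h1 ⟨a', b'⟩ h2 h3
    simp at h1 h2 h3
    ext <;> simp [h1, h2, h3]
  have sumSd : ∑ d ∈ D1, (Sd d).card = S.card := by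
    rw [card_eq_sum_card_image Prod.fst S]
    exact sum_congr rfl fun d _ => cardSd d
  set T : D → Finset A := fun d => univ.filter (fun a => Sum.inl a ∈ cov inc (Sd d)) with hT
  set B' : D → Finset B := fun d => univ.filter (fun b => Sum.inr b ∈ cov inc (Sd d)) with hB'
  have hcovd : ∀ d, (cov inc (Sd d)).card = (T d).card + (B' d).card := by
    intro d
    have : cov inc (Sd d) = (T d).disjSum (B' d) := by
      ext v
      rcases v with a | b <;> simp [hT, hB']
    rw [this, card_disjSum]
  have hTle : ∀ d, (T d).card ≤ (Sd d).card := by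
    intro d
    have hsub : T d ⊆ (Sd d).biUnion
        (fun e => univ.filter (fun a => ∃ i, inc e i = Sum.inl a)) := by
      intro a ha
      obtain ⟨e, he, i, hi⟩ := (mem_cov _ _ _).1 (mem_filter.1 ha).2
      exact mem_biUnion.2 ⟨e, he, by simpa using ⟨i, hi⟩⟩
    refine (card_le_card hsub).trans (card_biUnion_le.trans ?_)
    rw [card_eq_sum_ones]
    apply sum_le_sum
    intro e _
    apply card_le_one.2
    intro a ha b hb
    obtain ⟨i, hi⟩ := (mem_filter.1 ha).2
    obtain ⟨j, hj⟩ := (mem_filter.1 hb).2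
    exact hA e i j a b hi hj
  have hsd : ∀ d ∈ D1, Fintype.card ι * (Sd d).card + 1 ≤
      (T d).card + (B' d).card + (Sd d).card := by
    intro d hd
    rw [← hcovd]
    apply hX
    · obtain ⟨⟨d', e⟩, h1, h2⟩ := mem_image.1 hd
      simp at h2
      exact ⟨e, (mem_Sd _ _).2 (h2 ▸ h1)⟩
    · rw [cardSd]; exact (card_filter_le _ _).trans hSg
  have hsum := sum_le_sum hsd
  simp only [sum_add_distrib, ← mul_sum, sumSd] at hsum
  rw [sum_const, smul_eq_mul, mul_one] at hsum
  have hk : (D1.filter (fun d => 2 ≤ (T d).card)).card ≤ k := by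
    have h1 : (D1.filter (fun d => 2 ≤ (T d).card)).card * 2 ≤
        ∑ d ∈ D1.filter (fun d => 2 ≤ (T d).card), (Sd d).card := by
      rw [← smul_eq_mul, ← sum_const]
      apply sum_le_sum
      intro d hd
      exact (mem_filter.1 hd).2.trans (hTle d)
    have h2 : ∑ d ∈ D1.filter (fun d => 2 ≤ (T d).card), (Sd d).card ≤ ∑ d ∈ D1, (Sd d).card :=
      sum_le_sum_of_subset (filter_subset _ _)
    omega
  have htr := trace_count hF D1 hD1ne T hk
  have hcov : (D1.biUnion (fun d => (T d).image (incF d))).disjSum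
      (D1.biUnion (fun d => (B' d).image (Prod.mk d))) ⊆ cov (amInc inc incF) S := by
    intro v hv
    rw [mem_cov]
    rcases v with w | ⟨d, b⟩
    · rw [inl_mem_disjSum] at hv
      obtain ⟨d, hd, hw⟩ := mem_biUnion.1 hv
      obtain ⟨a, ha, rfl⟩ := mem_image.1 hw
      obtain ⟨e, he, i, hi⟩ := (mem_cov _ _ _).1 (mem_filter.1 ha).2
      exact ⟨(d, e), (mem_Sd _ _).1 he, i, by simp [amInc, hi]⟩
    · rw [inr_mem_disjSum] at hv
      obtain ⟨d', hd, hw⟩ := mem_biUnion.1 hv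
      obtain ⟨b', hb, hbb⟩ := mem_image.1 hw
      obtain ⟨e, he, i, hi⟩ := (mem_cov _ _ _).1 (mem_filter.1 hb).2
      exact ⟨(d', e), (mem_Sd _ _).1 he, i, by simp [amInc, hi, ← hbb]⟩
  have hcard := card_le_card hcov
  rw [card_disjSum] at hcard
  have hBc : (D1.biUnion (fun d => (B' d).image (Prod.mk d))).card = ∑ d ∈ D1, (B' d).card := by
    rw [card_biUnion]
    · exact sum_congr rfl fun d _ => card_image_of_injective _ (Prod.mk_right_injective d)
    · intro d _ d' _ hdd
      rw [Function.onFun, disjoint_left]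
      intro x hx hx'
      obtain ⟨_, _, rfl⟩ := mem_image.1 hx
      obtain ⟨_, _, h⟩ := mem_image.1 hx'
      exact hdd (by simpa using (congrArg Prod.fst h).symm)
  omega

/-- Existence of `k`-sparse uniform hypergraphs that are not `(c+1)`-colourable. -/
def HypExists (k : ℕ) : Prop :=
  ∀ (ι : Type) [Fintype ι] (c : ℕ), ∃ (W D : Type) (_ : Fintype W) (_ : Fintype D)
    (inc : D → ι → W), Sparse k inc ∧
      ∀ col : W → Fin (c + 1), ∃ d x, ∀ i, col (inc d i) = x

theorem partite_step {k g : ℕ} (hgk : g < 2 * k + 2) (hk : HypExists k) (ι : Type) [Fintype ι]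
    (c a : ℕ) (T : Finset (Fin a)) :
    ∃ (V E : Type) (_ : Fintype V) (_ : Fintype E) (inc : E → ι → V) (π : V → Fin a),
      Sparse g inc ∧ (∀ e, Function.Injective (fun i => π (inc e i))) ∧
      ∀ col : V → Fin (c + 1), ∃ χ : Fin a → Fin (c + 1), ∀ σ : ι ↪ Fin a,
        ∃ e, (∀ i, π (inc e i) = σ i) ∧ ∀ i, σ i ∈ T → col (inc e i) = χ (σ i) := by
  induction T using Finset.induction_on with
  | empty =>
    refine ⟨(ι ↪ Fin a) × ι, ι ↪ Fin a, inferInstance, inferInstance, fun σ i => (σ, i),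
      fun x => x.1 x.2, ?_, fun e => e.injective, fun col => ⟨fun _ => 0, fun σ => ⟨σ, ?_⟩⟩⟩
    · intro S hS _
      have : cov (fun (σ : ι ↪ Fin a) (i : ι) => (σ, i)) S = S ×ˢ univ := by
        ext ⟨σ, i⟩; simp [mem_cov]
      rw [this, card_product, card_univ, mul_comm]
      have := hS.card_pos
      omega
    · simp
  | insert p T hp ih =>
    obtain ⟨V, E, _, _, inc, π, hsp, hπ, hcol⟩ := ih
    obtain ⟨W, D, _, _, incF, hF, hFc⟩ := hk {v : V // π v = p} c
    let s : V ≃ {v : V // π v = p} ⊕ {v : V // ¬ π v = p} :=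
      (Equiv.sumCompl (fun v => π v = p)).symm
    let inc' : E → ι → {v : V // π v = p} ⊕ {v : V // ¬ π v = p} := fun e i => s (inc e i)
    have hs : ∀ v, Sum.elim (fun a => a.1) (fun b => b.1) (s v) = v := by
      intro v
      by_cases h : π v = p
      · simp [s, Equiv.sumCompl_symm_apply_of_pos, h]
      · simp [s, Equiv.sumCompl_symm_apply_of_neg, h]
    have hA : ∀ e i j a b, inc' e i = Sum.inl a → inc' e j = Sum.inl b → a = b := by
      intro e i j a b h1 h2
      have e1 := hs (inc e i)
      have e2 := hs (inc e j)
      simp only [inc'] at h1 h2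
      rw [h1] at e1
      rw [h2] at e2
      simp only [Sum.elim_inl] at e1 e2
      have : i = j := hπ e (by simp only [← e1, ← e2, a.2, b.2])
      subst this
      exact Subtype.ext (e1.trans e2.symm)
    have hπ' : ∀ d e i, Sum.elim (fun _ : W => p) (fun x : D × {v : V // ¬ π v = p} => π x.2.1)
        (amInc inc' incF (d, e) i) = π (inc e i) := by
      intro d e i
      have e1 := hs (inc e i)
      rcases h : s (inc e i) with x | x
      · rw [h] at e1
        simp only [Sum.elim_inl] at e1
        simp [amInc, inc', h, ← e1, x.2]
      · rw [h] at e1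
        simp only [Sum.elim_inr] at e1
        simp [amInc, inc', h, ← e1]
    refine ⟨W ⊕ (D × {v : V // ¬ π v = p}), D × E, inferInstance, inferInstance,
      amInc inc' incF, Sum.elim (fun _ => p) (fun x => π x.2.1),
      amalgam_sparse (hsp.map s s.injective) hF hgk hA, ?_, ?_⟩
    · rintro ⟨d, e⟩ i j hij
      simp only [hπ'] at hij
      exact hπ e hij
    · intro col
      obtain ⟨d, x, hd⟩ := hFc (fun w => col (Sum.inl w))
      obtain ⟨χ, hχ⟩ := hcol (fun v => col (Sum.map (incF d) (Prod.mk d) (s v)))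
      refine ⟨Function.update χ p x, fun σ => ?_⟩
      obtain ⟨e, he1, he2⟩ := hχ σ
      refine ⟨(d, e), fun i => by rw [hπ', he1], fun i hi => ?_⟩
      by_cases h : σ i = p
      · rw [h, Function.update_self]
        have : π (inc e i) = p := by rw [he1, h]
        simp [amInc, inc', s, Equiv.sumCompl_symm_apply_of_pos, this, hd]
      · rw [Function.update_of_ne h]
        exact he2 i (by simpa [h] using hi)

theorem hyp_exists (g : ℕ) : HypExists g := by
  induction g using Nat.strong_induction_on with
  | _ g ih =>
    intro ι _ c
    rcases Nat.eq_zero_or_pos g with rfl | hg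
    · refine ⟨Unit, Unit, inferInstance, inferInstance, fun _ _ => (), ?_, ?_⟩
      · intro S hS h
        have := hS.card_pos
        omega
      · intro col; exact ⟨(), col (), fun _ => rfl⟩
    · have hk : HypExists (g / 2) := ih _ (by omega)
      obtain ⟨V, E, i1, i2, inc, π, hsp, hπ, hcol⟩ :=
        partite_step (g := g) (by omega) hk ι c ((c + 1) * Fintype.card ι + 1) univ
      refine ⟨V, E, i1, i2, inc, hsp, fun col => ?_⟩
      obtain ⟨χ, hχ⟩ := hcol col
      obtain ⟨x, hx⟩ := Fintype.exists_lt_card_fiber_of_mul_lt_card χ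
        (n := Fintype.card ι) (by simp)
      have : Fintype.card ι ≤ Fintype.card {j // χ j = x} := by
        rw [Fintype.card_subtype]; exact hx.le
      obtain ⟨f⟩ := Function.Embedding.nonempty_of_card_le this
      obtain ⟨e, _, he⟩ := hχ (f.trans (Function.Embedding.subtype _))
      exact ⟨e, x, fun i => (he i (mem_univ _)).trans (f i).2⟩

theorem exists_sort {V : Type} [Fintype V] (y : V → ℕ) (hy : Function.Injective y) :
    ∃ a : Fin (Fintype.card V) ≃ V, StrictMono (fun i => y (a i)) := by
  let e : Fin (Fintype.card V) ≃ V := (Fintype.equivFin V).symm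
  refine ⟨(Tuple.sort (fun i => y (e i))).trans e, ?_⟩
  apply Monotone.strictMono_of_injective
  · exact Tuple.monotone_sort (fun i => y (e i))
  · exact hy.comp (Equiv.injective _)

theorem exists_align {V : Type} [Fintype V] (y z : V → ℕ) (hy : Function.Injective y)
    (hz : Function.Injective z) : ∃ σ : V ≃ V, ∀ u v, y u ≤ y v ↔ z (σ u) ≤ z (σ v) := by
  obtain ⟨a, ha⟩ := exists_sort y hy
  obtain ⟨b, hb⟩ := exists_sort z hz
  refine ⟨a.symm.trans b, fun u v => ?_⟩
  have h1 := ha.le_iff_le (a := a.symm u) (b := a.symm v)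
  have h2 := hb.le_iff_le (a := a.symm u) (b := a.symm v)
  simp only [Equiv.apply_symm_apply] at h1
  simp only [Equiv.trans_apply]
  exact h1.trans h2.symm

/-- The box spanned by the two endpoints contains no other point. -/
def EmptyBox {V : Type} (x y : V → ℕ) (p q : V) : Prop :=
  ∀ v, min (x p) (x q) ≤ x v → x v ≤ max (x p) (x q) →
    min (y p) (y q) ≤ y v → y v ≤ max (y p) (y q) → v = p ∨ v = q

theorem pendant_sparse {V E : Type} [Fintype V] {g : ℕ} {inc : E → Fin 2 → V}
    (h : Sparse g inc) :
    Sparse g (fun (s : V ⊕ E) (i : Fin 2) => (Sum.elim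
      (fun v => if i = 0 then Sum.inl v else Sum.inr v) (fun e => Sum.inr (inc e i)) s
        : V ⊕ V)) := by
  intro S hS hg
  set S1 := S.toLeft
  set S2 := S.toRight
  have hc : S1.card + S2.card = S.card := card_toLeft_add_card_toRight
  by_cases h2 : S2.Nonempty
  · have h3 := h S2 h2 (by omega)
    have hsub : S1.disjSum (cov inc S2) ⊆ cov (fun (s : V ⊕ E) (i : Fin 2) => (Sum.elim
      (fun v => if i = 0 then Sum.inl v else Sum.inr v) (fun e => Sum.inr (inc e i)) s
        : V ⊕ V)) S := by
      intro v hv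
      rw [mem_cov]
      rcases v with v | v
      · rw [inl_mem_disjSum] at hv
        exact ⟨Sum.inl v, mem_toLeft.1 hv, 0, by simp⟩
      · rw [inr_mem_disjSum, mem_cov] at hv
        obtain ⟨e, he, i, rfl⟩ := hv
        exact ⟨Sum.inr e, mem_toRight.1 he, i, by simp⟩
    have := card_le_card hsub
    rw [card_disjSum] at this
    simp only [Fintype.card_fin] at *
    omega
  · have hsub : S1.disjSum S1 ⊆ cov (fun (s : V ⊕ E) (i : Fin 2) => (Sum.elim
      (fun v => if i = 0 then Sum.inl v else Sum.inr v) (fun e => Sum.inr (inc e i)) s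
        : V ⊕ V)) S := by
      intro v hv
      rw [mem_cov]
      rcases v with v | v
      · rw [inl_mem_disjSum] at hv
        exact ⟨Sum.inl v, mem_toLeft.1 hv, 0, by simp⟩
      · rw [inr_mem_disjSum] at hv
        exact ⟨Sum.inl v, mem_toLeft.1 hv, 1, by simp⟩
    have := card_le_card hsub
    rw [card_disjSum] at this
    have h0 : S2.card = 0 := by rw [not_nonempty_iff_eq_empty.1 h2]; rfl
    have := hS.card_pos
    simp only [Fintype.card_fin] at *
    omega

theorem digit_le {M a b a' b' : ℕ} (hb' : b' < M) (h : a * M + b ≤ a' * M + b') :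
    a ≤ a' := by
  by_contra hlt
  have : (a' + 1) * M ≤ a * M := Nat.mul_le_mul_right _ (by omega)
  rw [add_mul] at this
  omega

theorem digit_eq {M a b a' b' : ℕ} (hb : b < M) (hb' : b' < M)
    (h : a * M + b = a' * M + b') : a = a' ∧ b = b' := by
  have h1 : a = a' := le_antisymm (digit_le hb' h.le) (digit_le hb h.ge)
  subst h1
  exact ⟨rfl, by omega⟩

theorem graph_exists (g : ℕ) (hg : 1 ≤ g) (c : ℕ) :
    ∃ (V E : Type) (_ : Fintype V) (_ : Fintype E) (inc : E → Fin 2 → V) (x y : V → ℕ),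
      Sparse g inc ∧ Function.Injective x ∧ Function.Injective y ∧
      (∀ e, EmptyBox x y (inc e 0) (inc e 1)) ∧
      ∀ col : V → Fin c, ∃ e, col (inc e 0) = col (inc e 1) := by
  induction c with
  | zero =>
    refine ⟨Unit, Empty, inferInstance, inferInstance, fun e => e.elim, fun _ => 0, fun _ => 0,
      ?_, fun _ _ _ => rfl, fun _ _ _ => rfl, fun e => e.elim, fun col => (col ()).elim0⟩
    rintro S ⟨e, _⟩
    exact e.elim
  | succ c ih =>
    obtain ⟨V, E, _, _, inc, x, y, hsp, hx, hy, hE, hcol⟩ := ih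
    obtain ⟨W, D, _, _, incF0, hF0, hFc0⟩ := hyp_exists g V c
    let ht : W → ℕ := fun w => (Fintype.equivFin W w).val
    have hht : Function.Injective ht := fun a b h =>
      (Fintype.equivFin W).injective (Fin.ext h)
    let t : D → ℕ := fun w => (Fintype.equivFin D w).val
    have htt : Function.Injective t := fun a b h =>
      (Fintype.equivFin D).injective (Fin.ext h)
    obtain ⟨N, hN⟩ : ∃ N, ∀ d, t d < N := ⟨_, fun d => (Fintype.equivFin D d).2⟩
    obtain ⟨M, hM⟩ : ∃ M, ∀ v, x v < M :=
      ⟨univ.sup x + 1, fun v => Nat.lt_succ_of_le (le_sup (mem_univ v))⟩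
    choose σ hσ using fun d => exists_align y (fun v => ht (incF0 d v)) hy
      (hht.comp (hF0.inj hg d))
    let incF : D → V → W := fun d v => incF0 d (σ d v)
    have hF : Sparse g incF := hF0.reindex σ
    have hFinj : ∀ d, Function.Injective (incF d) := hF.inj hg
    have hFmon : ∀ d u v, y u ≤ y v ↔ ht (incF d u) ≤ ht (incF d v) := hσ
    clear_value ht t
    let incP : V ⊕ E → Fin 2 → V ⊕ V := fun s i => Sum.elim
      (fun v => if i = 0 then Sum.inl v else Sum.inr v) (fun e => Sum.inr (inc e i)) s
    have hP : Sparse g incP := pendant_sparse hsp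
    have hA : ∀ e i j a b, incP e i = Sum.inl a → incP e j = Sum.inl b → a = b := by
      intro e i j a b h1 h2
      rcases e with v | e
      · simp only [incP, Sum.elim_inl] at h1 h2
        split_ifs at h1 h2
        simp_all
      · simp [incP] at h1
    refine ⟨W ⊕ (D × V), D × (V ⊕ E), inferInstance, inferInstance, amInc incP incF,
      Sum.elim (fun w => N * M + ht w) (fun p => t p.1 * M + x p.2),
      Sum.elim (fun w => ht w * (N + 1) + 0) (fun p => ht (incF p.1 p.2) * (N + 1) + (1 + t p.1)),
      amalgam_sparse hP hF (by omega) hA, ?_, ?_, ?_, ?_⟩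
    · rintro (w | ⟨d, v⟩) (w' | ⟨d', v'⟩) h
      · simp only [Sum.elim_inl] at h
        rw [hht (by omega : ht w = ht w')]
      · simp only [Sum.elim_inl, Sum.elim_inr] at h
        have := digit_le (hM v') h.le
        have := hN d'
        omega
      · simp only [Sum.elim_inl, Sum.elim_inr] at h
        have := digit_le (hM v) h.ge
        have := hN d
        omega
      · simp only [Sum.elim_inr] at h
        obtain ⟨h1, h2⟩ := digit_eq (hM v) (hM v') h
        rw [htt h1, hx h2]
    · rintro (w | ⟨d, v⟩) (w' | ⟨d', v'⟩) h
      · simp only [Sum.elim_inl] at h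
        obtain ⟨h1, h2⟩ := digit_eq (by omega) (by omega) h
        rw [hht h1]
      · simp only [Sum.elim_inl, Sum.elim_inr] at h
        have := hN d'
        obtain ⟨h1, h2⟩ := digit_eq (by omega) (by omega) h
        omega
      · simp only [Sum.elim_inl, Sum.elim_inr] at h
        have := hN d
        obtain ⟨h1, h2⟩ := digit_eq (by omega) (by omega) h
        omega
      · simp only [Sum.elim_inr] at h
        have := hN d
        have := hN d'
        obtain ⟨h1, h2⟩ := digit_eq (by omega) (by omega) h
        have h3 : d = d' := htt (by omega)
        subst h3
        rw [hFinj d (hht h1)]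
    · rintro ⟨d, v | e⟩
      · have e0 : amInc incP incF (d, Sum.inl v) 0 = Sum.inl (incF d v) := by
          simp [amInc, incP]
        have e1 : amInc incP incF (d, Sum.inl v) 1 = Sum.inr (d, v) := by
          simp [amInc, incP]
        rw [e0, e1]
        have hd := hN d
        rintro (w | ⟨d', v'⟩) h1 h2 h3 h4
        · simp only [Sum.elim_inl, Sum.elim_inr] at h3 h4
          rw [min_eq_left (by omega)] at h3
          rw [max_eq_right (by omega)] at h4
          have h5 := digit_le (by omega) h3
          have h6 := digit_le (by omega) h4
          left
          rw [hht (le_antisymm h6 h5)]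
        · simp only [Sum.elim_inl, Sum.elim_inr] at h1 h2 h3 h4
          have hd' := hN d'
          rw [min_eq_left (by omega)] at h3
          rw [max_eq_right (by omega)] at h4
          have h5 := digit_le (by omega) h3
          have h6 := digit_le (by omega) h4
          have h7 := le_antisymm h6 h5
          rw [h7] at h4
          have h8 : t d' ≤ t d := by omega
          have h9 : t d * M + x v ≤ N * M + ht (incF d v) := by
            have : (t d + 1) * M ≤ N * M := Nat.mul_le_mul_right _ hd
            have := hM v
            rw [add_mul] at *
            omega
          rw [min_eq_right h9] at h1
          have h10 := digit_le (hM v') h1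
          have h11 : d' = d := htt (le_antisymm h8 h10)
          subst h11
          right
          rw [hFinj _ (hht h7)]
      · have e0 : amInc incP incF (d, Sum.inr e) 0 = Sum.inr (d, inc e 0) := by
          simp [amInc, incP]
        have e1 : amInc incP incF (d, Sum.inr e) 1 = Sum.inr (d, inc e 1) := by
          simp [amInc, incP]
        rw [e0, e1]
        have hd := hN d
        rintro (w | ⟨d', v⟩) h1 h2 h3 h4
        · exfalso
          simp only [Sum.elim_inl, Sum.elim_inr, le_max_iff] at h2
          rcases h2 with h2 | h2
          · have := digit_le (hM _) h2
            omega
          · have := digit_le (hM _) h2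
            omega
        · simp only [Sum.elim_inr, le_max_iff, min_le_iff] at h1 h2 h3 h4
          have hdd : d' = d := by
            apply htt
            apply le_antisymm
            · rcases h2 with h2 | h2
              · exact digit_le (hM _) h2
              · exact digit_le (hM _) h2
            · rcases h1 with h1 | h1
              · exact digit_le (hM _) h1
              · exact digit_le (hM _) h1
          subst hdd
          have hb : ∀ u w, ht (incF d' u) * (N + 1) + (1 + t d') ≤
              ht (incF d' w) * (N + 1) + (1 + t d') → y u ≤ y w := fun u w h =>
            (hFmon _ _ _).2 (digit_le (by omega) h)
          have := hE e v (min_le_iff.2 (h1.imp (by omega) (by omega)))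
            (le_max_iff.2 (h2.imp (by omega) (by omega)))
            (min_le_iff.2 (h3.imp (hb _ _) (hb _ _)))
            (le_max_iff.2 (h4.imp (hb _ _) (hb _ _)))
          rcases this with h | h
          · left; rw [h]
          · right; rw [h]
    · intro col
      obtain ⟨d, k, hd0⟩ := hFc0 (fun w => col (Sum.inl w))
      have hd : ∀ v, col (Sum.inl (incF d v)) = k := fun v => hd0 (σ d v)
      by_cases hv : ∃ v, col (Sum.inr (d, v)) = k
      · obtain ⟨v, hv⟩ := hv
        refine ⟨(d, Sum.inl v), ?_⟩
        simp [amInc, incP, hd, hv]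
      · push Not at hv
        choose col' hcol' using fun v => Fin.exists_succAbove_eq (hv v)
        obtain ⟨e, he⟩ := hcol col'
        refine ⟨(d, Sum.inr e), ?_⟩
        simp [amInc, incP, ← hcol', he]

theorem girth_bound {U V E : Type} [Fintype V] {g : ℕ} {inc : E → Fin 2 → V}
    (hsp : Sparse g inc) (G : SimpleGraph U) (φ : U → V) (hφ : Function.Injective φ)
    (hG : ∀ u v, G.Adj u v → ∃ e, s(inc e 0, inc e 1) = s(φ u, φ v))
    (a : U) (w : G.Walk a a) (hw : w.IsCycle) : g ≤ w.length := by
  by_contra! hlt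
  have hG' : ∀ ε : Sym2 U, ε ∈ w.edges → ∃ e, s(inc e 0, inc e 1) = Sym2.map φ ε := by
    intro ε hε
    induction ε using Sym2.ind with
    | _ u v => exact hG u v (w.adj_of_mem_edges hε)
  have h3 := hw.three_le_length
  have hlen := w.length_edges
  have hcard : w.edges.toFinset.card = w.length := by
    rw [← hlen]
    exact List.toFinset_card_of_nodup hw.edges_nodup
  have : Nonempty E := by
    have hpos : 0 < w.edges.toFinset.card := by omega
    obtain ⟨ε, hε⟩ := card_pos.1 hpos
    obtain ⟨e, _⟩ := hG' ε (by simpa using hε)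
    exact ⟨e⟩
  choose! f hf using hG'
  have hinj : Set.InjOn f (w.edges.toFinset : Set (Sym2 U)) := by
    intro ε hε ε' hε' h
    have h1 := hf ε (by simpa using hε)
    have h2 := hf ε' (by simpa using hε')
    rw [h, h2] at h1
    exact (Sym2.map.injective hφ h1).symm
  have hScard : (w.edges.toFinset.image f).card = w.length := by
    rw [card_image_of_injOn hinj, hcard]
  have hmain := hsp (w.edges.toFinset.image f) (card_pos.1 (by omega)) (by omega)
  have hsup : w.support.toFinset.card ≤ w.length := by
    have h1 : w.support.toFinset ⊆ w.support.tail.toFinset := by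
      intro u hu
      have hu' : u ∈ w.support := by simpa using hu
      rw [← SimpleGraph.Walk.cons_tail_support] at hu'
      rcases List.mem_cons.1 hu' with rfl | h
      · simpa using w.end_mem_tail_support hw.not_nil
      · simpa using h
    refine (card_le_card h1).trans ((List.toFinset_card_le _).trans ?_)
    simp
  have hcov : cov inc (w.edges.toFinset.image f) ⊆ w.support.toFinset.image φ := by
    intro v hv
    obtain ⟨e, he, i, rfl⟩ := (mem_cov _ _ _).1 hv
    obtain ⟨ε, hε, rfl⟩ := mem_image.1 he
    have hε' : ε ∈ w.edges := by simpa using hε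
    have h1 := hf ε hε'
    have h2 : inc (f ε) i ∈ Sym2.map φ ε := by
      rw [← h1]
      fin_cases i <;> simp
    obtain ⟨u, hu, hu'⟩ := Sym2.mem_map.1 h2
    rw [← hu']
    apply mem_image_of_mem
    obtain ⟨u', rfl⟩ := hu
    simpa using w.fst_mem_support_of_mem_edges hε'
  have := (card_le_card hcov).trans card_image_le
  simp only [Fintype.card_fin] at hmain
  omega

end RectGirth

/-- For any positive integers `c` and `g`, there exist a finite set `P` of points in the
plane and a finite family `𝓡` of axis-parallel rectangles, each containing exactly two
points of `P`, such that the incidence graph on `P` (distinct `p, q` adjacent iff some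
`r ∈ 𝓡` satisfies `P ∩ r = {p, q}`) has girth at least `g` and chromatic number at
least `c + 1`. -/
theorem statement2 (c g : ℕ) (hc : 0 < c) (hg : 0 < g) :
    ∃ (P : Finset (ℝ × ℝ)) (𝓡 : Finset (ℝ × ℝ × ℝ × ℝ)),
      (∀ r ∈ 𝓡, r.1 ≤ r.2.1 ∧ r.2.2.1 ≤ r.2.2.2) ∧
      (∀ r ∈ 𝓡, ∃ p q : ℝ × ℝ, p ≠ q ∧
        (P : Set (ℝ × ℝ)) ∩ rectSet r = {p, q}) ∧
      (g : ℕ∞) ≤ (SimpleGraph.fromRel (fun p q : {x // x ∈ P} =>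
          ∃ r ∈ 𝓡, (P : Set (ℝ × ℝ)) ∩ rectSet r = {(p : ℝ × ℝ), (q : ℝ × ℝ)})).girth ∧
      (c + 1 : ℕ∞) ≤ (SimpleGraph.fromRel (fun p q : {x // x ∈ P} =>
          ∃ r ∈ 𝓡, (P : Set (ℝ × ℝ)) ∩ rectSet r =
            {(p : ℝ × ℝ), (q : ℝ × ℝ)})).chromaticNumber := by

  classical
  obtain ⟨V, E, _, _, inc, x, y, hsp, hx, hy, hE, hcol⟩ :=
    RectGirth.graph_exists g hg (c + 2)
  let pt : V → ℝ × ℝ := fun v => ((x v : ℝ), (y v : ℝ))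
  have hpt : Function.Injective pt := by
    intro u v h
    have h1 := congrArg Prod.fst h
    simp only [pt, Nat.cast_inj] at h1
    exact hx h1
  let rc : E → ℝ × ℝ × ℝ × ℝ := fun e =>
    (((min (x (inc e 0)) (x (inc e 1)) : ℕ) : ℝ), ((max (x (inc e 0)) (x (inc e 1)) : ℕ) : ℝ),
      ((min (y (inc e 0)) (y (inc e 1)) : ℕ) : ℝ), ((max (y (inc e 0)) (y (inc e 1)) : ℕ) : ℝ))
  let P : Finset (ℝ × ℝ) := Finset.univ.image pt
  let 𝓡 : Finset (ℝ × ℝ × ℝ × ℝ) := Finset.univ.image rc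
  have hmem : ∀ e v, pt v ∈ rectSet (rc e) ↔
      (min (x (inc e 0)) (x (inc e 1)) ≤ x v ∧ x v ≤ max (x (inc e 0)) (x (inc e 1))) ∧
      (min (y (inc e 0)) (y (inc e 1)) ≤ y v ∧ y v ≤ max (y (inc e 0)) (y (inc e 1))) := by
    intro e v
    simp only [rectSet, rc, pt, Set.mem_prod, Set.mem_Icc, Nat.cast_le]
  have hrect : ∀ e, (P : Set (ℝ × ℝ)) ∩ rectSet (rc e) = {pt (inc e 0), pt (inc e 1)} := by
    intro e
    ext z
    simp only [Set.mem_inter_iff, Set.mem_insert_iff, Set.mem_singleton_iff]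
    constructor
    · rintro ⟨hz, hz'⟩
      obtain ⟨v, _, rfl⟩ := Finset.mem_image.1 (Finset.mem_coe.1 hz)
      rw [hmem] at hz'
      rcases hE e v hz'.1.1 hz'.1.2 hz'.2.1 hz'.2.2 with h | h
      · left; rw [h]
      · right; rw [h]
    · rintro (rfl | rfl)
      · refine ⟨by simp [P], ?_⟩
        rw [hmem]
        simp
      · refine ⟨by simp [P], ?_⟩
        rw [hmem]
        simp
  have hne : ∀ e, inc e 0 ≠ inc e 1 := fun e h => by
    have := hsp.inj hg e h
    simp at this
  have hφ : ∀ p : {p // p ∈ P}, ∃ v, pt v = p.1 := by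
    rintro ⟨p, hp⟩
    obtain ⟨v, _, hv⟩ := Finset.mem_image.1 hp
    exact ⟨v, hv⟩
  choose φ hφ using hφ
  have hφi : Function.Injective φ := by
    intro p q h
    apply Subtype.ext
    rw [← hφ p, ← hφ q, h]
  have hP : ∀ v, pt v ∈ P := fun v => Finset.mem_image_of_mem _ (Finset.mem_univ v)
  refine ⟨P, 𝓡, ?_, ?_, ?_⟩
  · intro r hr
    obtain ⟨e, _, rfl⟩ := Finset.mem_image.1 hr
    simp only [rc, Nat.cast_le]
    exact ⟨min_le_max, min_le_max⟩
  · intro r hr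
    obtain ⟨e, _, rfl⟩ := Finset.mem_image.1 hr
    exact ⟨_, _, fun h => hne e (hpt h), hrect e⟩
  set G := SimpleGraph.fromRel (fun p q : {x // x ∈ P} =>
          ∃ r ∈ 𝓡, (P : Set (ℝ × ℝ)) ∩ rectSet r = {(p : ℝ × ℝ), (q : ℝ × ℝ)}) with hGdef
  have hadj : ∀ p q, G.Adj p q → ∃ e, s(inc e 0, inc e 1) = s(φ p, φ q) := by
    have key : ∀ p q : {x // x ∈ P}, (∃ r ∈ 𝓡, (P : Set (ℝ × ℝ)) ∩ rectSet r =
        {(p : ℝ × ℝ), (q : ℝ × ℝ)}) → ∃ e, s(inc e 0, inc e 1) = s(φ p, φ q) := by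
      rintro p q ⟨r, hr, h⟩
      obtain ⟨e, _, rfl⟩ := Finset.mem_image.1 hr
      refine ⟨e, ?_⟩
      rw [hrect, ← hφ p, ← hφ q, Set.pair_eq_pair_iff] at h
      rw [Sym2.eq_iff]
      exact h.imp (And.imp (@hpt _ _) (@hpt _ _)) (And.imp (@hpt _ _) (@hpt _ _))
    intro p q h
    rw [hGdef, SimpleGraph.fromRel_adj] at h
    rcases h.2 with h | h
    · exact key p q h
    · obtain ⟨e, he⟩ := key q p h
      exact ⟨e, he.trans Sym2.eq_swap⟩
  have hnot : ¬ G.Colorable (c + 2) := by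
    rintro ⟨C⟩
    obtain ⟨e, he⟩ := hcol (fun v => C ⟨pt v, hP v⟩)
    refine C.valid ?_ he
    rw [hGdef, SimpleGraph.fromRel_adj]
    refine ⟨fun h => hne e (hpt (congrArg Subtype.val h)), Or.inl ⟨rc e, ?_, hrect e⟩⟩
    exact Finset.mem_image_of_mem _ (Finset.mem_univ e)
  have hac : ¬ G.IsAcyclic := fun h => hnot (h.colorable_two.mono (by omega))
  constructor
  · obtain ⟨a, w, hw, hl⟩ := SimpleGraph.exists_girth_eq_length.2 hac
    rw [hl]
    exact_mod_cast RectGirth.girth_bound hsp G φ hφi hadj a w hw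
  · have hle : ((c + 1 : ℕ) : ℕ∞) ≤ G.chromaticNumber := by
      rw [SimpleGraph.le_chromaticNumber_iff_colorable]
      intro m hm
      by_contra hlt
      exact hnot (hm.mono (by omega))
    exact_mod_cast hle
end

section
/- Let D be an infinite set of positive integers, and let c, k be positive integers. Then there exists a finite set V of integers such that for every coloring χ : V → {1,...,c}, there is a finite arithmetic progression A whose difference belongs to D such that A ∩ V is monochromatic and |A ∩ V| ≥ k. -/
/-- The finite arithmetic progression `{b, b + d, …, b + (m-1)d}`. -/
def AP (b d : ℤ) (m : ℕ) : Set ℤ := {x | ∃ i : ℕ, i < m ∧ x = b + i * d}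

/-- A coloring of the indexed points `g` has a monochromatic progression segment. -/
def Hit {c : ℕ} (k : ℕ) (F : Finset ℕ) {ι : Type} (g : ι → ℤ) (χ : ι → Fin c) : Prop :=
  ∃ d ∈ F, ∃ i0 i1 : ι,
    k ≤ ({i | g i0 ≤ g i ∧ g i ≤ g i1 ∧ (d : ℤ) ∣ g i - g i0} : Set ι).ncard ∧
    ∀ i ∈ ({i | g i0 ≤ g i ∧ g i ≤ g i1 ∧ (d : ℤ) ∣ g i - g i0} : Set ι),
    ∀ j ∈ ({i | g i0 ≤ g i ∧ g i ≤ g i1 ∧ (d : ℤ) ∣ g i - g i0} : Set ι), χ i = χ j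

/-- The permutation places `k` equally colored elements first. -/
def GoodPerm {c M : ℕ} (k : ℕ) (ρ : Fin M → Fin c) (π : Equiv.Perm (Fin M)) : Prop :=
  ∀ a b, (π a : ℕ) < k → (π b : ℕ) < k → ρ a = ρ b

lemma exists_goodPerm {c k M : ℕ} (hk : 0 < k) (hM : M = c * (k - 1) + 1)
    (ρ : Fin M → Fin c) : ∃ π, GoodPerm k ρ π := by
  classical
  obtain ⟨y, hy⟩ : ∃ y : Fin c, k - 1 < (Finset.univ.filter (fun a => ρ a = y)).card := by
    have := Finset.exists_lt_card_fiber_of_mul_lt_card_of_maps_to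
      (s := (Finset.univ : Finset (Fin M))) (t := (Finset.univ : Finset (Fin c))) (f := ρ)
      (n := k - 1) (by simp) (by simp [hM])
    obtain ⟨y, -, hy⟩ := this
    exact ⟨y, hy⟩
  obtain ⟨A, hA, hAc⟩ := Finset.exists_subset_card_eq (show k ≤ _ by omega : k ≤ (Finset.univ.filter (fun a => ρ a = y)).card)
  have hkM : k ≤ M := by
    have := Finset.card_le_univ A
    simpa [hAc] using this
  have e : {a // a ∈ A} ≃ {a : Fin M // (a : ℕ) < k} := by
    apply Fintype.equivOfCardEq
    rw [Fintype.card_coe, hAc, Fintype.card_subtype]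
    have : (Finset.univ.filter (fun a : Fin M => (a : ℕ) < k)) =
        (Finset.univ : Finset (Fin k)).map (Fin.castLEEmb hkM) := by
      ext a
      simp only [Finset.mem_filter, Finset.mem_univ, true_and, Finset.mem_map]
      constructor
      · intro h; exact ⟨⟨a, h⟩, by ext; simp⟩
      · rintro ⟨b, rfl⟩; simp
    rw [this]; simp
  refine ⟨e.extendSubtype, ?_⟩
  have key : ∀ a, ((e.extendSubtype a : Fin M) : ℕ) < k → ρ a = y := by
    intro a ha
    by_contra hne
    have : a ∉ A := fun h => hne (by simpa using hA h)
    exact e.extendSubtype_not_mem a this ha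
  intro a b ha hb
  rw [key a ha, key b hb]

open Classical in
lemma counting {c M k : ℕ} {ι : Type} [Fintype ι] (Bad : Finset (ι → Fin c))
    (hG : ∀ ρ : Fin M → Fin c, ∃ π, GoodPerm k ρ π) :
    ∃ π : ι → Equiv.Perm (Fin M),
      (Finset.univ.filter (fun χ : ι × Fin M → Fin c =>
        (∀ a, (fun i => χ (i, a)) ∈ Bad) ∧ ∀ i, ¬ GoodPerm k (fun a => χ (i, a)) (π i))).card
        * M.factorial ^ Fintype.card ι
      ≤ Bad.card ^ M * (M.factorial - 1) ^ Fintype.card ι := by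
  set X := Finset.univ.filter (fun χ : ι × Fin M → Fin c => ∀ a, (fun i => χ (i, a)) ∈ Bad) with hX
  have hXc : X.card ≤ Bad.card ^ M := by
    have : X.card ≤ (Fintype.piFinset (fun _ : Fin M => Bad)).card := by
      apply Finset.card_le_card_of_injOn (fun χ a i => χ (i, a))
      · intro χ hχ
        simp [hX] at hχ ⊢
        exact hχ
      · intro χ _ χ' _ h
        funext ⟨i, a⟩
        exact congrFun (congrFun h a) i
    simpa using this
  have hrow : ∀ χ : ι × Fin M → Fin c,
      (Finset.univ.filter (fun π : ι → Equiv.Perm (Fin M) =>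
        ∀ i, ¬ GoodPerm k (fun a => χ (i, a)) (π i))).card ≤ (M.factorial - 1) ^ Fintype.card ι := by
    intro χ
    have : (Finset.univ.filter (fun π : ι → Equiv.Perm (Fin M) =>
        ∀ i, ¬ GoodPerm k (fun a => χ (i, a)) (π i))) =
        Fintype.piFinset (fun i => Finset.univ.filter
          (fun p => ¬ GoodPerm k (fun a => χ (i, a)) p)) := by
      ext π; simp
    rw [this, Fintype.card_piFinset]
    calc _ ≤ ∏ i : ι, (M.factorial - 1) := by
          apply Finset.prod_le_prod'
          intro i _
          obtain ⟨p, hp⟩ := hG (fun a => χ (i, a))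
          have : (Finset.univ.filter
            (fun p => ¬ GoodPerm k (fun a => χ (i, a)) p)).card < (Finset.univ : Finset (Equiv.Perm (Fin M))).card := by
            apply Finset.card_lt_card
            rw [Finset.filter_ssubset]
            exact ⟨p, by simp, by simpa using hp⟩
          rw [Finset.card_univ, Fintype.card_perm, Fintype.card_fin] at this
          omega
      _ = _ := by simp
  have hsum : ∑ π : ι → Equiv.Perm (Fin M), (Finset.univ.filter (fun χ : ι × Fin M → Fin c =>
        (∀ a, (fun i => χ (i, a)) ∈ Bad) ∧ ∀ i, ¬ GoodPerm k (fun a => χ (i, a)) (π i))).card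
        ≤ Bad.card ^ M * (M.factorial - 1) ^ Fintype.card ι := by
    calc _ = ∑ π : ι → Equiv.Perm (Fin M), (X.filter (fun χ =>
          ∀ i, ¬ GoodPerm k (fun a => χ (i, a)) (π i))).card := by
          simp only [hX, Finset.filter_filter]
      _ = ∑ χ ∈ X, (Finset.univ.filter (fun π : ι → Equiv.Perm (Fin M) =>
        ∀ i, ¬ GoodPerm k (fun a => χ (i, a)) (π i))).card := by
          simp only [Finset.card_filter]
          rw [Finset.sum_comm]
      _ ≤ ∑ χ ∈ X, (M.factorial - 1) ^ Fintype.card ι := Finset.sum_le_sum (fun χ _ => hrow χ)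
      _ = X.card * (M.factorial - 1) ^ Fintype.card ι := by simp
      _ ≤ _ := Nat.mul_le_mul_right _ hXc
  by_contra! hcon
  have h2 := Finset.sum_lt_sum_of_nonempty (s := (Finset.univ : Finset (ι → Equiv.Perm (Fin M))))
    Finset.univ_nonempty (fun π _ => hcon π)
  rw [Finset.sum_const, Finset.card_univ, Fintype.card_fun, Fintype.card_perm,
    Fintype.card_fin, smul_eq_mul, ← Finset.sum_mul] at h2
  have h3 := Nat.mul_le_mul_right (M.factorial ^ Fintype.card ι) hsum
  rw [mul_comm] at h2
  exact absurd h2 (not_lt.mpr h3)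

/-- New points: shuffled copies of the old ones. -/
def newG {M : ℕ} {ι : Type} (g : ι → ℤ) (Q P : ℤ) (π : ι → Equiv.Perm (Fin M)) :
    ι × Fin M → ℤ :=
  fun x => g x.1 + Q * (x.2 : ℕ) + P * M * (M * g x.1 + (π x.1 x.2 : ℕ))

lemma newG_lt {M : ℕ} {ι : Type} (g : ι → ℤ) (hg : Function.Injective g) (Q P : ℤ)
    (hQ : 0 < Q) (hP : Q ≤ P) (π : ι → Equiv.Perm (Fin M)) (x y : ι × Fin M)
    (h : g x.1 < g y.1 ∨ (x.1 = y.1 ∧ (π x.1 x.2 : ℕ) < (π y.1 y.2 : ℕ))) :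
    newG g Q P π x < newG g Q P π y := by
  obtain ⟨i, a⟩ := x
  obtain ⟨j, b⟩ := y
  simp only [newG] at *
  have ha := a.2
  have hM : (0 : ℤ) < M := by exact_mod_cast (by omega : 0 < M)
  have hgle : g i ≤ g j := by
    rcases h with h | ⟨h, _⟩
    · exact h.le
    · rw [h]
  have hpa := (π i a).2
  have hu : (M : ℤ) * g i + (π i a : ℕ) + 1 ≤ M * g j + (π j b : ℕ) := by
    rcases h with h | ⟨h, h'⟩
    · have : (M : ℤ) * (g i + 1) ≤ M * g j := mul_le_mul_of_nonneg_left h hM.le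
      have h2 : ((π i a : ℕ) : ℤ) + 1 ≤ M := by exact_mod_cast hpa
      have h3 : (0 : ℤ) ≤ (π j b : ℕ) := by positivity
      linarith
    · subst h
      have : ((π i a : ℕ) : ℤ) + 1 ≤ (π i b : ℕ) := by exact_mod_cast h'
      linarith
  have h1 : P * M * (M * g i + (π i a : ℕ) + 1) ≤ P * M * (M * g j + (π j b : ℕ)) :=
    mul_le_mul_of_nonneg_left hu (mul_nonneg (hQ.le.trans hP) hM.le)
  have h2 : Q * (a : ℕ) < Q * M := by
    apply mul_lt_mul_of_pos_left _ hQ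
    exact_mod_cast ha
  have h3 : Q * M ≤ P * M := mul_le_mul_of_nonneg_right hP hM.le
  have h4 : 0 ≤ Q * (b : ℕ) := by positivity
  linarith

lemma newG_le_iff {M : ℕ} {ι : Type} (g : ι → ℤ) (hg : Function.Injective g) (Q P : ℤ)
    (hQ : 0 < Q) (hP : Q ≤ P) (π : ι → Equiv.Perm (Fin M)) (x y : ι × Fin M) :
    newG g Q P π x ≤ newG g Q P π y ↔
      (g x.1 < g y.1 ∨ (x.1 = y.1 ∧ (π x.1 x.2 : ℕ) ≤ (π y.1 y.2 : ℕ))) := by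
  constructor
  · intro h
    by_contra hcon
    push Not at hcon
    have : newG g Q P π y < newG g Q P π x := by
      apply newG_lt g hg Q P hQ hP
      rcases hcon.1.lt_or_eq with h1 | h1
      · exact Or.inl h1
      · have := hg h1
        exact Or.inr ⟨this, hcon.2 this.symm⟩
    omega
  · rintro (h | ⟨h, h'⟩)
    · exact (newG_lt g hg Q P hQ hP π x y (Or.inl h)).le
    · rcases h'.lt_or_eq with h1 | h1
      · exact (newG_lt g hg Q P hQ hP π x y (Or.inr ⟨h, h1⟩)).le
      · obtain ⟨i, a⟩ := x
        obtain ⟨j, b⟩ := y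
        simp only at h h1
        subst h
        have : a = b := (π i).injective (Fin.ext h1)
        rw [this]

/-- Inductive configuration. -/
lemma config (D : Set ℕ) (hD : D.Infinite) (hDpos : ∀ d ∈ D, 0 < d)
    (c k M : ℕ) (hc : 0 < c) (hk : 0 < k) (hM : M = c * (k - 1) + 1) (r : ℝ) (hr0 : 0 ≤ r)
    (hr : r ^ M = ((M.factorial - 1 : ℕ) : ℝ) / (M.factorial : ℝ)) (l : ℕ) :
    ∀ (Q B : ℤ), 0 < Q → 0 < B → ∃ (ι : Type) (_ : Fintype ι) (_ : Nonempty ι)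
      (g : ι → ℤ) (F : Finset ℕ), Function.Injective g ∧ (∀ i, Q ∣ g i) ∧ (∀ d ∈ F, d ∈ D) ∧
      (∀ i j, ∀ d ∈ F, ∀ t : ℤ, t ≠ 0 → |t| < B → ¬ (d : ℤ) ∣ g i - g j + t) ∧
      (({χ : ι → Fin c | ¬ Hit k F g χ}.ncard : ℕ) : ℝ) ≤ (c * r ^ l) ^ Fintype.card ι := by
  classical
  induction l with
  | zero =>
    intro Q B hQ hB
    refine ⟨Unit, inferInstance, inferInstance, fun _ => 0, ∅, ?_, by simp, by simp, by simp, ?_⟩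
    · intro a b _; rfl
    · have : ({χ : Unit → Fin c | ¬ Hit k ∅ (fun _ => (0 : ℤ)) χ}.ncard) ≤ c := by
        refine (Set.ncard_le_card _).trans ?_
        simp
      simpa using this
  | succ l ih =>
    intro Q B hQ hB
    obtain ⟨d, hdD, hdB⟩ := hD.exists_gt B.toNat
    have hdB' : B < d := by omega
    set Q' : ℤ := Q * d with hQ'
    have hd0 : (0 : ℤ) < d := by omega
    have hQ'0 : 0 < Q' := by positivity
    have hBQ' : B < Q' := by nlinarith
    have hM0 : 0 < M := by omega
    obtain ⟨ι, _, _, g, F, hg, hgQ, hFD, hsep, hcount⟩ :=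
      ih Q' (Q' * M + B) hQ'0 (by positivity)
    have hkM : k ≤ M := by
      have : 1 * (k - 1) ≤ c * (k - 1) := Nat.mul_le_mul_right _ hc
      omega
    obtain ⟨π, hπ⟩ := counting (M := M) (k := k)
      ({χ : ι → Fin c | ¬ Hit k F g χ}.toFinite.toFinset) (exists_goodPerm hk hM)
    set P : ℤ := Q' * ((∏ e ∈ F, e : ℕ) : ℤ) with hPdef
    have hprod : 0 < ∏ e ∈ F, e := Finset.prod_pos (fun e he => hDpos e (hFD e he))
    have hPQ : Q' ≤ P := by
      have : (1 : ℤ) ≤ ((∏ e ∈ F, e : ℕ) : ℤ) := by exact_mod_cast hprod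
      nlinarith
    have hPF : ∀ e ∈ F, (e : ℤ) ∣ P := fun e he =>
      Dvd.dvd.mul_left (Int.natCast_dvd_natCast.mpr (Finset.dvd_prod_of_mem _ he)) _
    have hle := newG_le_iff g hg Q' P hQ'0 hPQ π
    have hdiv : ∀ x, Q' ∣ newG g Q' P π x := by
      intro x
      unfold newG
      refine dvd_add (dvd_add (hgQ _) (Dvd.intro _ rfl)) ?_
      rw [mul_assoc]
      exact Dvd.dvd.mul_right (Dvd.intro _ rfl) _
    have hdd : ∀ x, (d : ℤ) ∣ newG g Q' P π x := fun x =>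
      (Dvd.intro_left Q rfl : (d : ℤ) ∣ Q').trans (hdiv x)
    -- congruences modulo old moduli
    have hcong : ∀ e ∈ F, ∀ x y : ι × Fin M, ∀ t : ℤ,
        ((e : ℤ) ∣ newG g Q' P π x - newG g Q' P π y + t ↔
          (e : ℤ) ∣ g x.1 - g y.1 + (Q' * ((x.2 : ℕ) - (y.2 : ℕ) : ℤ) + t)) := by
      intro e he x y t
      have : newG g Q' P π x - newG g Q' P π y + t =
        (g x.1 - g y.1 + (Q' * ((x.2 : ℕ) - (y.2 : ℕ) : ℤ) + t)) +
        P * (M * (M * g x.1 + (π x.1 x.2 : ℕ)) - M * (M * g y.1 + (π y.1 y.2 : ℕ))) := by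
        unfold newG; ring
      rw [this]
      exact dvd_add_left ((hPF e he).mul_right _)
    have hbd : ∀ x y : ι × Fin M, |Q' * ((x.2 : ℕ) - (y.2 : ℕ) : ℤ)| ≤ Q' * M := by
      intro x y
      rw [abs_mul, abs_of_pos hQ'0]
      apply mul_le_mul_of_nonneg_left _ hQ'0.le
      have := x.2.2
      have := y.2.2
      rw [abs_le]; constructor <;> omega
    have hsame : ∀ e ∈ F, ∀ x y : ι × Fin M,
        (e : ℤ) ∣ newG g Q' P π x - newG g Q' P π y → x.2 = y.2 := by
      intro e he x y h
      by_contra hne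
      have h' := (hcong e he x y 0).1 (by simpa using h)
      refine hsep x.1 y.1 e he _ ?_ ?_ h'
      · rw [add_zero]
        apply mul_ne_zero hQ'0.ne'
        intro h0
        exact hne (Fin.ext (by omega))
      · rw [add_zero]
        have := hbd x y
        omega
    refine ⟨ι × Fin M, inferInstance, ⟨⟨Classical.arbitrary ι, ⟨0, hM0⟩⟩⟩, newG g Q' P π,
      insert d F, ?_, ?_, ?_, ?_, ?_⟩
    · intro x y hxy
      have h1 := (hle x y).1 hxy.le
      have h2 := (hle y x).1 hxy.ge
      have h3 : x.1 = y.1 := by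
        rcases h1 with h1 | h1
        · rcases h2 with h2 | h2
          · omega
          · exact h2.1.symm
        · exact h1.1
      obtain ⟨i, a⟩ := x
      obtain ⟨j, b⟩ := y
      simp only at h3
      subst h3
      simp at h1 h2
      have : a = b := (π i).injective (le_antisymm h1 h2)
      rw [this]
    · intro x
      exact (Dvd.intro _ rfl : Q ∣ Q').trans (hdiv x)
    · intro e he
      rcases Finset.mem_insert.1 he with rfl | he
      · exact hdD
      · exact hFD e he
    · intro x y e he t ht0 htB hdvd
      rcases Finset.mem_insert.1 he with rfl | he
      · have h1 : (e : ℤ) ∣ t := (dvd_add_right (dvd_sub (hdd x) (hdd y))).1 hdvd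
        have := Int.eq_zero_of_abs_lt_dvd h1 (by omega)
        exact ht0 this
      · rw [hcong e he x y t] at hdvd
        refine hsep x.1 y.1 e he _ ?_ ?_ hdvd
        · intro h0
          have h1 : Q' ∣ t := by
            have : t = Q' * (-((x.2 : ℕ) - (y.2 : ℕ) : ℤ)) := by linarith
            exact Dvd.intro _ this.symm
          exact ht0 (Int.eq_zero_of_abs_lt_dvd h1 (by omega))
        · have := abs_add_le (Q' * ((x.2 : ℕ) - (y.2 : ℕ) : ℤ)) t
          have := hbd x y
          omega
    · -- counting
      have hsub : {χ : ι × Fin M → Fin c | ¬ Hit k (insert d F) (newG g Q' P π) χ} ⊆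
          ((Finset.univ.filter (fun χ : ι × Fin M → Fin c =>
          (∀ a, (fun i => χ (i, a)) ∈ ({χ : ι → Fin c | ¬ Hit k F g χ}.toFinite.toFinset)) ∧
          ∀ i, ¬ GoodPerm k (fun a => χ (i, a)) (π i)) : Finset _) : Set _) := by
        intro χ hχ
        simp only [Set.mem_ofPred_eq] at hχ
        simp only [Finset.coe_filter, Finset.mem_univ, true_and, Set.mem_ofPred_eq,
          Set.Finite.mem_toFinset]
        refine ⟨fun a hhit => hχ ?_, fun i hgood => hχ ?_⟩
        · obtain ⟨e, he, i0, i1, hcard, hmono⟩ := hhit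
          have hset : {x : ι × Fin M | newG g Q' P π (i0, a) ≤ newG g Q' P π x ∧
              newG g Q' P π x ≤ newG g Q' P π (i1, a) ∧
              (e : ℤ) ∣ newG g Q' P π x - newG g Q' P π (i0, a)} =
              (fun i => (i, a)) '' {i | g i0 ≤ g i ∧ g i ≤ g i1 ∧ (e : ℤ) ∣ g i - g i0} := by
            have hle' : ∀ i j, newG g Q' P π (i, a) ≤ newG g Q' P π (j, a) ↔ g i ≤ g j := by
              intro i j
              rw [hle]
              constructor
              · rintro (h | h)
                · exact h.le
                · simp only at h; rw [h.1]
              · intro h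
                rcases h.lt_or_eq with h | h
                · exact Or.inl h
                · have := hg h
                  subst this
                  exact Or.inr ⟨rfl, le_rfl⟩
            have hcong' : ∀ i j, (e : ℤ) ∣ newG g Q' P π (i, a) - newG g Q' P π (j, a) ↔
                (e : ℤ) ∣ g i - g j := by
              intro i j
              have := hcong e he (i, a) (j, a) 0
              simpa using this
            ext ⟨i, b⟩
            simp only [Set.mem_ofPred_eq, Set.mem_image, Prod.mk.injEq]
            constructor
            · rintro ⟨h1, h2, h3⟩
              have hb : b = a := hsame e he _ _ h3
              subst hb
              exact ⟨i, ⟨(hle' _ _).1 h1, (hle' _ _).1 h2, (hcong' _ _).1 h3⟩, rfl, rfl⟩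
            · rintro ⟨j, ⟨h1, h2, h3⟩, rfl, rfl⟩
              exact ⟨(hle' _ _).2 h1, (hle' _ _).2 h2, (hcong' _ _).2 h3⟩
          refine ⟨e, Finset.mem_insert_of_mem he, (i0, a), (i1, a), ?_, ?_⟩
          · rw [hset, Set.ncard_image_of_injective _ (fun i j h => by simpa using h)]
            exact hcard
          · rw [hset]
            rintro _ ⟨i, hi, rfl⟩ _ ⟨j, hj, rfl⟩
            exact hmono i hi j hj
        · have hset : {x : ι × Fin M |
              newG g Q' P π (i, (π i).symm ⟨0, hM0⟩) ≤ newG g Q' P π x ∧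
              newG g Q' P π x ≤ newG g Q' P π (i, (π i).symm ⟨k - 1, by omega⟩) ∧
              (d : ℤ) ∣ newG g Q' P π x - newG g Q' P π (i, (π i).symm ⟨0, hM0⟩)} =
              (fun a : Fin k => (i, (π i).symm (Fin.castLE hkM a))) '' Set.univ := by
            ext ⟨j, b⟩
            simp only [Set.mem_ofPred_eq, Set.mem_image, Prod.mk.injEq, Set.mem_univ, true_and]
            rw [hle, hle]
            simp only [Equiv.apply_symm_apply]
            constructor
            · rintro ⟨h1, h2, -⟩
              have hij : i = j := by
                rcases h1 with h1 | h1
                · rcases h2 with h2 | h2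
                  · omega
                  · exact h2.1.symm
                · exact h1.1
              subst hij
              simp at h2
              refine ⟨⟨π i b, by omega⟩, rfl, ?_⟩
              rw [Equiv.symm_apply_eq]
              ext; simp
            · rintro ⟨a, rfl, rfl⟩
              refine ⟨Or.inr ⟨rfl, by simp⟩, Or.inr ⟨rfl, ?_⟩, dvd_sub (hdd _) (hdd _)⟩
              simp
              omega
          refine ⟨d, Finset.mem_insert_self _ _, (i, (π i).symm ⟨0, hM0⟩),
            (i, (π i).symm ⟨k - 1, by omega⟩), ?_, ?_⟩
          · rw [hset, Set.ncard_image_of_injective]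
            · simp
            · intro a b h
              simpa using h
          · rw [hset]
            rintro _ ⟨a, -, rfl⟩ _ ⟨b, -, rfl⟩
            exact hgood _ _ (by simp) (by simp)
      have h1 := Set.ncard_le_ncard hsub (Finset.finite_toSet _)
      rw [Set.ncard_coe_finset] at h1
      rw [← Set.ncard_eq_toFinset_card] at hπ
      have h2 := (Nat.mul_le_mul_right (M.factorial ^ Fintype.card ι) h1).trans hπ
      have hq : (0 : ℝ) < (M.factorial : ℝ) := by exact_mod_cast M.factorial_pos
      have h3 : (({χ : ι × Fin M → Fin c | ¬ Hit k (insert d F) (newG g Q' P π) χ}.ncard : ℕ) : ℝ)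
          * (M.factorial : ℝ) ^ Fintype.card ι ≤
          (({χ : ι → Fin c | ¬ Hit k F g χ}.ncard : ℕ) : ℝ) ^ M *
            ((M.factorial - 1 : ℕ) : ℝ) ^ Fintype.card ι := by exact_mod_cast h2
      have h4 : (({χ : ι → Fin c | ¬ Hit k F g χ}.ncard : ℕ) : ℝ) ^ M ≤
          ((c * r ^ l) ^ Fintype.card ι) ^ M := pow_le_pow_left₀ (by positivity) hcount M
      have h5 : ((M.factorial - 1 : ℕ) : ℝ) = r ^ M * (M.factorial : ℝ) := by
        rw [hr]; field_simp
      rw [Fintype.card_prod, Fintype.card_fin]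
      refine le_of_mul_le_mul_right (h3.trans ?_) (pow_pos hq (Fintype.card ι))
      calc _ ≤ ((c * r ^ l) ^ Fintype.card ι) ^ M *
            ((M.factorial - 1 : ℕ) : ℝ) ^ Fintype.card ι := by gcongr
        _ = _ := by
          rw [h5, mul_pow (r ^ M), ← mul_assoc]
          congr 1
          rw [← pow_mul, ← pow_mul, mul_comm M, ← mul_pow, pow_succ, mul_assoc]

theorem statement6 (D : Set ℕ) (hD : D.Infinite) (hDpos : ∀ d ∈ D, 0 < d)
    (c k : ℕ) (hc : 0 < c) (hk : 0 < k) :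
    ∃ V : Finset ℤ, ∀ χ : ℤ → Fin c,
      ∃ (b : ℤ) (d : ℕ) (m : ℕ), d ∈ D ∧ 1 ≤ m ∧
        k ≤ (AP b (d : ℤ) m ∩ (V : Set ℤ)).ncard ∧
        ∀ x ∈ AP b (d : ℤ) m ∩ (V : Set ℤ),
          ∀ y ∈ AP b (d : ℤ) m ∩ (V : Set ℤ), χ x = χ y := by
  classical
  set M := c * (k - 1) + 1 with hM
  have hM0 : M ≠ 0 := by omega
  have hq : (0 : ℝ) < (M.factorial : ℝ) := by exact_mod_cast M.factorial_pos
  set s : ℝ := ((M.factorial - 1 : ℕ) : ℝ) / (M.factorial : ℝ) with hs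
  have hs0 : 0 ≤ s := by positivity
  have hs1 : s < 1 := by
    rw [hs, div_lt_one hq]
    have := M.factorial_pos
    exact_mod_cast (by omega : M.factorial - 1 < M.factorial)
  obtain ⟨r, hr0, hr⟩ : ∃ r : ℝ, 0 ≤ r ∧ r ^ M = s :=
    ⟨s ^ ((M : ℝ)⁻¹), by positivity, Real.rpow_inv_natCast_pow hs0 hM0⟩
  have hr1 : r < 1 := by
    by_contra! h
    have := one_le_pow₀ h (n := M)
    linarith
  have hc' : (0 : ℝ) < c := by exact_mod_cast hc
  obtain ⟨l, hl⟩ := exists_pow_lt_of_lt_one (show (0 : ℝ) < 1 / c by positivity) hr1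
  have hl' : (c : ℝ) * r ^ l < 1 := by
    rw [lt_div_iff₀ hc'] at hl; linarith
  obtain ⟨ι, _, _, g, F, hg, -, hFD, -, hcount⟩ :=
    config D hD hDpos c k M hc hk hM r hr0 hr l 1 1 one_pos one_pos
  have hlt : (({χ : ι → Fin c | ¬ Hit k F g χ}.ncard : ℕ) : ℝ) < 1 :=
    hcount.trans_lt (pow_lt_one₀ (by positivity) hl' Fintype.card_ne_zero)
  have hzero : {χ : ι → Fin c | ¬ Hit k F g χ}.ncard = 0 := by
    have : {χ : ι → Fin c | ¬ Hit k F g χ}.ncard < 1 := by exact_mod_cast hlt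
    omega
  rw [Set.ncard_eq_zero (Set.toFinite _)] at hzero
  refine ⟨Finset.univ.image g, fun χ => ?_⟩
  have hhit : Hit k F g (χ ∘ g) := by
    by_contra h
    have : (χ ∘ g) ∈ {χ : ι → Fin c | ¬ Hit k F g χ} := h
    rw [hzero] at this
    exact this
  obtain ⟨d, hdF, i0, i1, hcard, hmono⟩ := hhit
  have hd0 : (0 : ℤ) < d := by exact_mod_cast hDpos d (hFD d hdF)
  have hset : AP (g i0) (d : ℤ) (((g i1 - g i0) / d + 1).toNat) ∩
      ((Finset.univ.image g : Finset ℤ) : Set ℤ) =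
      g '' {i | g i0 ≤ g i ∧ g i ≤ g i1 ∧ (d : ℤ) ∣ g i - g i0} := by
    ext x
    simp only [AP, Finset.coe_image, Finset.coe_univ, Set.image_univ, Set.mem_inter_iff,
      Set.mem_ofPred_eq, Set.mem_range, Set.mem_image]
    constructor
    · rintro ⟨⟨n, hn, hx⟩, i, rfl⟩
      have h1 : (n : ℤ) ≤ (g i1 - g i0) / d := by omega
      rw [Int.le_ediv_iff_mul_le hd0] at h1
      refine ⟨i, ⟨?_, ?_, ?_⟩, rfl⟩
      · have : 0 ≤ (n : ℤ) * d := by positivity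
        linarith
      · linarith
      · exact ⟨n, by rw [hx]; ring⟩
    · rintro ⟨i, ⟨h1, h2, ⟨q, hq⟩⟩, rfl⟩
      have hq0 : 0 ≤ q := by
        by_contra! h
        nlinarith
      refine ⟨⟨q.toNat, ?_, ?_⟩, i, rfl⟩
      · have : q ≤ (g i1 - g i0) / d := by
          rw [Int.le_ediv_iff_mul_le hd0]; linarith
        omega
      · rw [Int.toNat_of_nonneg hq0]; linarith
  refine ⟨g i0, d, ((g i1 - g i0) / d + 1).toNat, hFD d hdF, ?_, ?_, ?_⟩
  · by_contra! h
    have h0 : ((g i1 - g i0) / d + 1).toNat = 0 := by omega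
    have hempty : g '' {i | g i0 ≤ g i ∧ g i ≤ g i1 ∧ (d : ℤ) ∣ g i - g i0} = ∅ := by
      rw [← hset, h0]
      ext x; simp [AP]
    rw [Set.image_eq_empty] at hempty
    rw [hempty] at hcard
    simp at hcard
    omega
  · rw [hset, Set.ncard_image_of_injective _ hg]
    exact hcard
  · rw [hset]
    rintro _ ⟨i, hi, rfl⟩ _ ⟨j, hj, rfl⟩
    exact hmono i hi j hj
end

section
/- For any positive integers c and k, there exists a finite set V of integers such that for every coloring χ : V → {1,...,c}, there is a finite arithmetic progression A whose difference is a power of 2 such that A ∩ V is monochromatic and |A ∩ V| ≥ k. -/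
open Finset in
lemma greedy_kill {ι α β : Type*} [DecidableEq ι] [DecidableEq β] [Nonempty β]
    (D : ℕ) (hD : 0 < D) (T : ι → Finset β) (f : ι → α → β) (S : Finset α) (J : Finset ι)
    (hT : ∀ j ∈ J, #(T j) ≤ D) (hf : ∀ j ∈ J, ∀ a, f j a ∈ T j) :
    ∃ P : ι → β, (#{a ∈ S | ∀ j ∈ J, f j a ≠ P j} : ℝ) ≤ (1 - 1 / (D : ℝ)) ^ #J * #S := by
  have hD' : (0 : ℝ) < D := by exact_mod_cast hD
  have hq : (0 : ℝ) ≤ 1 - 1 / (D : ℝ) := by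
    have : 1 / (D : ℝ) ≤ 1 := by
      rw [div_le_one hD']; exact_mod_cast hD
    linarith
  induction J using Finset.induction_on with
  | empty => exact ⟨fun _ => Classical.arbitrary β, by simp⟩
  | insert j J hj ih =>
    obtain ⟨P, hP⟩ := ih (fun i hi => hT i (mem_insert_of_mem hi))
      (fun i hi => hf i (mem_insert_of_mem hi))
    set S' := {a ∈ S | ∀ j ∈ J, f j a ≠ P j} with hS'
    have key : ∃ p : β, (#S' : ℝ) ≤ D * #{a ∈ S' | f j a = p} := by
      by_contra! hcon
      have h1 : #S' = ∑ b ∈ T j, #{a ∈ S' | f j a = b} :=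
        card_eq_sum_card_fiberwise (fun a _ => hf j (mem_insert_self _ _) a)
      have hne : S'.Nonempty := by
        rw [nonempty_iff_ne_empty]
        intro h0
        have := hcon (Classical.arbitrary β)
        simp [h0] at this
      obtain ⟨a, ha⟩ := hne
      have hTne : (T j).Nonempty := ⟨_, hf j (mem_insert_self _ _) a⟩
      have h2 : (D : ℝ) * #S' < #(T j) * #S' := by
        calc (D : ℝ) * #S' = ∑ b ∈ T j, (D : ℝ) * #{a ∈ S' | f j a = b} := by
              rw [← mul_sum]; congr 1; exact_mod_cast h1
          _ < ∑ b ∈ T j, (#S' : ℝ) := sum_lt_sum_of_nonempty hTne (fun b _ => hcon b)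
          _ = #(T j) * #S' := by simp
      have h3 : (#(T j) : ℝ) ≤ D := by exact_mod_cast hT j (mem_insert_self _ _)
      have : (#(T j) : ℝ) * #S' ≤ D * #S' := by gcongr
      linarith
    obtain ⟨p, hp⟩ := key
    refine ⟨Function.update P j p, ?_⟩
    have hset : {a ∈ S | ∀ i ∈ insert j J, f i a ≠ Function.update P j p i}
        = {a ∈ S' | ¬ f j a = p} := by
      ext a
      simp only [hS', mem_filter, mem_insert, forall_eq_or_imp, Function.update_self]
      have : (∀ i ∈ J, f i a ≠ Function.update P j p i) ↔ (∀ i ∈ J, f i a ≠ P i) := by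
        refine forall₂_congr fun i hi => ?_
        rw [Function.update_of_ne (by rintro rfl; exact hj hi)]
      rw [this]; tauto
    rw [hset, card_insert_of_notMem hj, pow_succ]
    have hsum : (#{a ∈ S' | f j a = p} : ℝ) + #{a ∈ S' | ¬ f j a = p} = #S' := by
      exact_mod_cast card_filter_add_card_filter_not (s := S') (fun a => f j a = p)
    have h4 : (#S' : ℝ) / D ≤ #{a ∈ S' | f j a = p} := by
      rw [div_le_iff₀ hD']; linarith
    calc (#{a ∈ S' | ¬ f j a = p} : ℝ) ≤ (1 - 1 / (D : ℝ)) * #S' := by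
          have : (1 - 1 / (D : ℝ)) * #S' = #S' - #S' / D := by ring
          linarith
      _ ≤ (1 - 1 / (D : ℝ)) * ((1 - 1 / (D : ℝ)) ^ #J * #S) := by gcongr
      _ = _ := by ring

open Finset in
lemma windows_exist {n : ℕ} (h : Fin n → ℕ) (Q w R : ℕ) (hw : 0 < w) (hQ : ∀ i, h i < Q)
    (hn : w * (R + Q) ≤ n) :
    ∃ (J : Finset (Σ _ : ℕ, ℕ)) (W : (Σ _ : ℕ, ℕ) → Finset (Fin n)), R ≤ #J ∧
      (∀ j ∈ J, #(W j) = w) ∧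
      (∀ i j, ∀ x, x ∈ W i → x ∈ W j → i = j) ∧
      (∀ j, ∀ x ∈ W j, ∀ y ∈ W j, h x = h y) ∧
      (∀ j, ∀ x ∈ W j, ∀ z ∈ W j, ∀ y, x ≤ y → y ≤ z → h y = h x → y ∈ W j) := by
  classical
  let rk : Fin n → ℕ := fun i => #{j | j < i ∧ h j = h i}
  let C : ℕ → Finset (Fin n) := fun r => {i | h i = r}
  let W : (Σ _ : ℕ, ℕ) → Finset (Fin n) := fun p => {i | h i = p.1 ∧ rk i / w = p.2}
  have rk_mono : ∀ x y, x ≤ y → h x = h y → rk x ≤ rk y := by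
    intro x y hxy he
    apply card_le_card
    intro j
    simp only [mem_filter, mem_univ, true_and]
    rintro ⟨h1, h2⟩
    exact ⟨h1.trans_le hxy, h2.trans he⟩
  have rk_lt : ∀ x y, x < y → h x = h y → rk x < rk y := by
    intro x y hxy he
    apply card_lt_card
    rw [ssubset_iff_of_subset]
    · exact ⟨x, by simp [hxy, he], by simp⟩
    · intro j
      simp only [mem_filter, mem_univ, true_and]
      rintro ⟨h1, h2⟩
      exact ⟨h1.trans hxy, h2.trans he⟩
  have rk_inj : ∀ r, Set.InjOn rk (C r : Set (Fin n)) := by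
    intro r x hx y hy hxy
    simp only [C, coe_filter, mem_univ, true_and, Set.mem_ofPred_eq] at hx hy
    rcases lt_trichotomy x y with h1 | h1 | h1
    · exact absurd hxy (rk_lt x y h1 (hx.trans hy.symm)).ne
    · exact h1
    · exact absurd hxy (rk_lt y x h1 (hy.trans hx.symm)).ne'
  have rk_img : ∀ r, (C r).image rk = range #(C r) := by
    intro r
    apply eq_of_subset_of_card_le
    · intro v hv
      obtain ⟨i, hi, rfl⟩ := mem_image.1 hv
      simp only [C, mem_filter, mem_univ, true_and] at hi
      rw [mem_range]
      apply card_lt_card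
      rw [ssubset_iff_of_subset]
      · exact ⟨i, by simp [C, hi], by simp⟩
      · intro j
        simp only [C, mem_filter, mem_univ, true_and]
        rintro ⟨_, h2⟩
        exact h2.trans hi
    · rw [card_range, card_image_of_injOn (rk_inj r)]
  refine ⟨(range Q).sigma (fun r => range (#(C r) / w)), W, ?_, ?_, ?_, ?_, ?_⟩
  · rw [card_sigma]
    simp only [card_range]
    have h1 : n = ∑ r ∈ range Q, #(C r) := by
      have := card_eq_sum_card_fiberwise (s := (univ : Finset (Fin n))) (t := range Q) (f := h)
        (fun i _ => by simpa using hQ i)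
      simpa [C] using this
    have h2 : n ≤ w * (∑ r ∈ range Q, #(C r) / w + Q) := by
      calc n = ∑ r ∈ range Q, #(C r) := h1
        _ ≤ ∑ r ∈ range Q, (w * (#(C r) / w) + w) := by
            apply sum_le_sum
            intro r _
            have := Nat.div_add_mod #(C r) w
            have := Nat.mod_lt #(C r) hw
            omega
        _ = w * (∑ r ∈ range Q, #(C r) / w + Q) := by
            rw [sum_add_distrib, ← mul_sum]; simp; ring
    have := Nat.le_of_mul_le_mul_left (hn.trans h2) hw
    omega
  · rintro ⟨r, q⟩ hj
    simp only [mem_sigma, mem_range] at hj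
    have hqw : (q + 1) * w ≤ #(C r) := by
      rw [← Nat.le_div_iff_mul_le hw]; exact hj.2
    have hWC : W ⟨r, q⟩ = {i ∈ C r | rk i / w = q} := by
      ext i; simp [W, C]
    have himg : (W ⟨r, q⟩).image rk = Ico (q * w) (q * w + w) := by
      rw [hWC, ← filter_image (p := fun v => v / w = q), rk_img]
      ext v
      simp only [mem_filter, mem_range, mem_Ico]
      rw [Nat.div_eq_iff hw]
      have : (q + 1) * w = q * w + w := by ring
      constructor
      · rintro ⟨_, h1, h2⟩; omega
      · rintro ⟨h1, h2⟩; omega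
    have := card_image_of_injOn (f := rk) (s := W ⟨r, q⟩)
      ((rk_inj r).mono (by rw [hWC]; exact_mod_cast filter_subset _ _))
    rw [← this, himg]; simp
  · rintro ⟨r, q⟩ ⟨r', q'⟩ x hx hy
    simp only [W, mem_filter, mem_univ, true_and] at hx hy
    obtain ⟨rfl, rfl⟩ := hx
    obtain ⟨rfl, rfl⟩ := hy
    rfl
  · rintro ⟨r, q⟩ x hx y hy
    simp only [W, mem_filter, mem_univ, true_and] at hx hy
    rw [hx.1, hy.1]
  · rintro ⟨r, q⟩ x hx z hz y hxy hyz he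
    simp only [W, mem_filter, mem_univ, true_and] at hx hz ⊢
    have h1 := Nat.div_le_div_right (c := w) (rk_mono x y hxy he.symm)
    have h2 := Nat.div_le_div_right (c := w) (rk_mono y z hyz (by rw [he, hx.1, hz.1]))
    refine ⟨he.trans hx.1, ?_⟩
    omega

/-- The coloring `χ` has a long monochromatic run at some level at most `t`. -/
def HasRun {n c : ℕ} (k t : ℕ) (g : Fin n → ℕ) (χ : Fin n → Fin c) : Prop :=
  ∃ s ≤ t, ∃ a b : Fin n,
    (∀ i, a ≤ i → i ≤ b → g i % 2 ^ s = g a % 2 ^ s → χ i = χ a) ∧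
    k ≤ (Finset.univ.filter (fun i => a ≤ i ∧ i ≤ b ∧ g i % 2 ^ s = g a % 2 ^ s)).card

open Finset Classical in
lemma level_step {n c : ℕ} (k t R : ℕ) (hc : 0 < c) (hk : 0 < k) (g : Fin n → ℕ)
    (hg : ∀ i, g i < 2 ^ t) (hn : k * c * (R + 2 ^ t) ≤ n) :
    ∃ g' : Fin n → ℕ, (∀ i, g' i < 2 ^ (t + 1)) ∧
      (#{χ : Fin n → Fin c | ¬ HasRun k (t + 1) g' χ} : ℝ) ≤
        (1 - 1 / ((2 ^ (k * c) : ℕ) : ℝ)) ^ R * #{χ : Fin n → Fin c | ¬ HasRun k t g χ} := by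
  obtain ⟨J, W, hJ, hWc, hWd, hWh, hWconv⟩ :=
    windows_exist g (2 ^ t) (k * c) R (Nat.mul_pos hk hc) hg hn
  have hpat : ∀ j, ∀ χ : Fin n → Fin c, ∃ P : Finset (Fin n), j ∈ J →
      P ⊆ W j ∧ k ≤ #P ∧ ∀ x ∈ P, ∀ y ∈ P, χ x = χ y := by
    intro j χ
    by_cases hj : j ∈ J
    · have : Nonempty (Fin c) := ⟨⟨0, hc⟩⟩
      obtain ⟨y, _, hy⟩ := exists_le_card_fiber_of_mul_le_card_of_maps_to
        (s := W j) (t := (univ : Finset (Fin c))) (f := χ) (n := k)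
        (fun _ _ => mem_univ _) univ_nonempty (by rw [hWc j hj]; simp [mul_comm])
      refine ⟨{x ∈ W j | χ x = y}, fun _ => ⟨filter_subset _ _, hy, ?_⟩⟩
      intro x hx z hz
      rw [(mem_filter.1 hx).2, (mem_filter.1 hz).2]
    · exact ⟨∅, fun h => absurd h hj⟩
  choose f hf using hpat
  obtain ⟨P, hP⟩ := greedy_kill (2 ^ (k * c)) (by positivity) (fun j => (W j).powerset) f
    {χ : Fin n → Fin c | ¬ HasRun k t g χ} J
    (fun j hj => by rw [card_powerset, hWc j hj])
    (fun j hj χ => mem_powerset.2 (hf j χ hj).1)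
  let B : Fin n → Prop := fun i => ∃ j ∈ J, i ∈ P j ∧ i ∈ W j
  let g' : Fin n → ℕ := fun i => g i + 2 ^ t * (if B i then 1 else 0)
  have hmod : ∀ s ≤ t, ∀ i, g' i % 2 ^ s = g i % 2 ^ s := by
    intro s hs i
    obtain ⟨d, rfl⟩ := Nat.exists_eq_add_of_le hs
    simp only [g', pow_add, mul_assoc, Nat.add_mul_mod_self_left]
  have hlt : ∀ i, g' i < 2 ^ (t + 1) := by
    intro i
    have := hg i
    simp only [g', pow_succ]
    split_ifs <;> omega
  refine ⟨g', hlt, ?_⟩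
  have hq0 : (0 : ℝ) ≤ 1 - 1 / ((2 ^ (k * c) : ℕ) : ℝ) := by
    have h1 : (1 : ℝ) ≤ ((2 ^ (k * c) : ℕ) : ℝ) := by exact_mod_cast Nat.one_le_two_pow
    have : 1 / ((2 ^ (k * c) : ℕ) : ℝ) ≤ 1 := by
      rw [div_le_one (by linarith)]; exact h1
    linarith
  have hq1 : 1 - 1 / ((2 ^ (k * c) : ℕ) : ℝ) ≤ 1 := by
    have : 0 ≤ 1 / ((2 ^ (k * c) : ℕ) : ℝ) := by positivity
    linarith
  refine le_trans ?_ (hP.trans ?_)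
  · norm_cast
    apply card_le_card
    intro χ
    simp only [mem_filter, mem_univ, true_and]
    intro hχ
    refine ⟨?_, ?_⟩
    · rintro ⟨s, hs, a, b, h1, h2⟩
      apply hχ
      refine ⟨s, by omega, a, b, ?_, ?_⟩
      · simpa only [hmod s hs] using h1
      · simpa only [hmod s hs] using h2
    · intro j hj hfj
      apply hχ
      obtain ⟨hsub, hcard, hmono⟩ := hf j χ hj
      rw [hfj] at hsub hcard hmono
      have hne : (P j).Nonempty := card_pos.1 (by omega)
      have hmin := min'_mem (P j) hne
      have hmax := max'_mem (P j) hne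
      have hiff : ∀ i, ((P j).min' hne ≤ i ∧ i ≤ (P j).max' hne ∧
          g' i % 2 ^ (t + 1) = g' ((P j).min' hne) % 2 ^ (t + 1)) ↔ i ∈ P j := by
        intro i
        rw [Nat.mod_eq_of_lt (hlt _), Nat.mod_eq_of_lt (hlt _)]
        have hBmin : B ((P j).min' hne) := ⟨j, hj, hmin, hsub hmin⟩
        have hgi := hg i
        have hgm := hg ((P j).min' hne)
        constructor
        · rintro ⟨h1, h2, h3⟩
          simp only [g', if_pos hBmin] at h3
          by_cases hB : B i
          · rw [if_pos hB] at h3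
            have hiW : i ∈ W j := hWconv j _ (hsub hmin) _ (hsub hmax) i h1 h2 (by omega)
            obtain ⟨j', _, hp, hw'⟩ := hB
            rw [hWd j j' i hiW hw']
            exact hp
          · rw [if_neg hB] at h3
            omega
        · intro hi
          refine ⟨min'_le _ _ hi, le_max' _ _ hi, ?_⟩
          have hBi : B i := ⟨j, hj, hi, hsub hi⟩
          simp only [g', if_pos hBmin, if_pos hBi]
          rw [hWh j i (hsub hi) _ (hsub hmin)]
      refine ⟨t + 1, le_rfl, (P j).min' hne, (P j).max' hne, ?_, ?_⟩
      · intro i h1 h2 h3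
        exact hmono _ ((hiff i).1 ⟨h1, h2, h3⟩) _ hmin
      · refine hcard.trans (card_le_card ?_)
        intro i hi
        simpa using (hiff i).2 hi
  · exact mul_le_mul_of_nonneg_right (pow_le_pow_of_le_one hq0 hq1 hJ) (Nat.cast_nonneg _)

open Finset Classical in
lemma levels {n c : ℕ} (k m R : ℕ) (hc : 0 < c) (hk : 0 < k)
    (hn : k * c * (R + 2 ^ m) ≤ n) (t : ℕ) (ht : t ≤ m) :
    ∃ g : Fin n → ℕ, (∀ i, g i < 2 ^ t) ∧
      (#{χ : Fin n → Fin c | ¬ HasRun k t g χ} : ℝ) ≤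
        (1 - 1 / ((2 ^ (k * c) : ℕ) : ℝ)) ^ (R * t) * (c : ℝ) ^ n := by
  have hq0 : (0 : ℝ) ≤ 1 - 1 / ((2 ^ (k * c) : ℕ) : ℝ) := by
    have h1 : (1 : ℝ) ≤ ((2 ^ (k * c) : ℕ) : ℝ) := by exact_mod_cast Nat.one_le_two_pow
    have : 1 / ((2 ^ (k * c) : ℕ) : ℝ) ≤ 1 := by
      rw [div_le_one (by linarith)]; exact h1
    linarith
  induction t with
  | zero =>
    refine ⟨fun _ => 0, by simp, ?_⟩
    have : #{χ : Fin n → Fin c | ¬ HasRun k 0 (fun _ => 0) χ} ≤ c ^ n := by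
      refine (card_filter_le _ _).trans ?_
      simp
    simp only [mul_zero, pow_zero, one_mul]
    exact_mod_cast this
  | succ t ih =>
    obtain ⟨g, hg, hcount⟩ := ih (by omega)
    have hpow : 2 ^ t ≤ 2 ^ m := Nat.pow_le_pow_right (by norm_num) (by omega)
    obtain ⟨g', hg', hcount'⟩ := level_step k t R hc hk g hg
      (le_trans (Nat.mul_le_mul_left _ (by omega)) hn)
    refine ⟨g', hg', hcount'.trans ?_⟩
    rw [Nat.mul_succ, add_comm (R * t) R, pow_add, mul_assoc]
    exact mul_le_mul_of_nonneg_left hcount (pow_nonneg hq0 _)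

open Finset Classical in
lemma exists_good (c k : ℕ) (hc : 0 < c) (hk : 0 < k) :
    ∃ (n m : ℕ) (g : Fin n → ℕ), (∀ i, g i < 2 ^ m) ∧
      ∀ χ : Fin n → Fin c, HasRun k m g χ := by
  set q : ℝ := 1 - 1 / ((2 ^ (k * c) : ℕ) : ℝ) with hq
  have hq0 : 0 ≤ q := by
    have h1 : (1 : ℝ) ≤ ((2 ^ (k * c) : ℕ) : ℝ) := by exact_mod_cast Nat.one_le_two_pow
    have : 1 / ((2 ^ (k * c) : ℕ) : ℝ) ≤ 1 := by
      rw [div_le_one (by linarith)]; exact h1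
    linarith
  have hq1 : q < 1 := by
    have : 0 < 1 / ((2 ^ (k * c) : ℕ) : ℝ) := by positivity
    linarith
  have hcR : (0 : ℝ) < c := by exact_mod_cast hc
  have hC : (0 : ℝ) < (c : ℝ) ^ (k * c * 2) := by positivity
  obtain ⟨m, hm⟩ := exists_pow_lt_of_lt_one (inv_pos.2 hC) hq1
  obtain ⟨g, hg, hcount⟩ := levels (n := k * c * (2 ^ m + 2 ^ m)) (c := c) k m (2 ^ m) hc hk
    le_rfl m le_rfl
  refine ⟨_, m, g, hg, ?_⟩
  have hlt : q ^ (2 ^ m * m) * (c : ℝ) ^ (k * c * (2 ^ m + 2 ^ m)) < 1 := by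
    have e : q ^ (2 ^ m * m) * (c : ℝ) ^ (k * c * (2 ^ m + 2 ^ m))
        = (q ^ m * (c : ℝ) ^ (k * c * 2)) ^ (2 ^ m) := by
      rw [mul_pow, ← pow_mul, ← pow_mul]
      congr 2 <;> ring
    rw [e]
    apply pow_lt_one₀ (by positivity)
    · calc q ^ m * (c : ℝ) ^ (k * c * 2) < ((c : ℝ) ^ (k * c * 2))⁻¹ * (c : ℝ) ^ (k * c * 2) := by
            exact mul_lt_mul_of_pos_right hm hC
        _ = 1 := inv_mul_cancel₀ hC.ne'
    · positivity
  have h0 := hcount.trans_lt hlt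
  have h1 : #{χ : Fin (k * c * (2 ^ m + 2 ^ m)) → Fin c | ¬ HasRun k m g χ} = 0 := by
    have : #{χ : Fin (k * c * (2 ^ m + 2 ^ m)) → Fin c | ¬ HasRun k m g χ} < 1 := by
      exact_mod_cast h0
    omega
  intro χ
  by_contra hχ
  rw [card_eq_zero] at h1
  have : χ ∈ ({χ | ¬ HasRun k m g χ} : Finset (Fin (k * c * (2 ^ m + 2 ^ m)) → Fin c)) := by
    simpa using hχ
  rw [h1] at this
  simp at this

/-- For any positive integers `c, k`, there exists a finite set `V` of integers such that
for every `c`-coloring of the integers, there is a finite arithmetic progression `A`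
whose difference is a power of 2 such that `A ∩ V` is monochromatic and has at least `k`
elements. -/
theorem statement7 (c k : ℕ) (hc : 0 < c) (hk : 0 < k) :
    ∃ V : Finset ℤ, ∀ χ : ℤ → Fin c,
      ∃ (b : ℤ) (t : ℕ) (m : ℕ), 1 ≤ m ∧
        k ≤ (AP b (2 ^ t) m ∩ (V : Set ℤ)).ncard ∧
        ∀ x ∈ AP b (2 ^ t) m ∩ (V : Set ℤ),
          ∀ y ∈ AP b (2 ^ t) m ∩ (V : Set ℤ), χ x = χ y := by
  obtain ⟨n, m, g, hg, hrun⟩ := exists_good c k hc hk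
  let v : Fin n → ℕ := fun i => g i + 2 ^ m * (i : ℕ)
  have vmono : StrictMono v := by
    intro i j hij
    have h1 : (i : ℕ) + 1 ≤ j := hij
    have h2 := Nat.mul_le_mul_left (2 ^ m) h1
    have := hg i
    simp only [v]
    rw [Nat.mul_add] at h2
    omega
  have vmod : ∀ s ≤ m, ∀ i, v i % 2 ^ s = g i % 2 ^ s := by
    intro s hs i
    obtain ⟨d, rfl⟩ := Nat.exists_eq_add_of_le hs
    simp only [v, pow_add, mul_assoc, Nat.add_mul_mod_self_left]
  refine ⟨Finset.univ.image (fun i => (v i : ℤ)), fun χ => ?_⟩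
  obtain ⟨s, hs, a, b, hmono, hcard⟩ := hrun (fun i => χ (v i))
  have hset : AP (v a) (2 ^ s) ((v b - v a) / 2 ^ s + 1) ∩
      ((Finset.univ.image (fun i => (v i : ℤ)) : Finset ℤ) : Set ℤ) =
      (((Finset.univ.filter (fun i => a ≤ i ∧ i ≤ b ∧ g i % 2 ^ s = g a % 2 ^ s)).image
        (fun i => (v i : ℤ)) : Finset ℤ) : Set ℤ) := by
    have hab : a ≤ b := by
      by_contra hlt
      have : (Finset.univ.filter
          (fun i => a ≤ i ∧ i ≤ b ∧ g i % 2 ^ s = g a % 2 ^ s)) = ∅ := by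
        ext i
        simp only [Finset.mem_filter, Finset.mem_univ, true_and, Finset.notMem_empty, iff_false]
        rintro ⟨h1, h2, _⟩
        exact hlt (h1.trans h2)
      rw [this] at hcard
      simp at hcard
      omega
    have hvab : v a ≤ v b := vmono.monotone hab
    have hpos : 0 < 2 ^ s := by positivity
    ext x
    simp only [AP, Set.mem_inter_iff, Set.mem_ofPred_eq, Finset.coe_image, Set.mem_image,
      Finset.mem_coe, Finset.mem_univ, true_and, Finset.mem_filter]
    constructor
    · rintro ⟨⟨l, hl, hx⟩, i, rfl⟩
      have hx' : v i = v a + l * 2 ^ s := by exact_mod_cast hx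
      refine ⟨i, ⟨?_, ?_, ?_⟩, rfl⟩
      · rw [← vmono.le_iff_le]; omega
      · rw [← vmono.le_iff_le]
        have := (Nat.le_div_iff_mul_le hpos).1 (Nat.le_of_lt_succ hl)
        omega
      · rw [← vmod s hs, ← vmod s hs, hx', Nat.add_mul_mod_self_right]
    · rintro ⟨i, ⟨h1, h2, h3⟩, rfl⟩
      refine ⟨?_, i, rfl⟩
      have hai : v a ≤ v i := vmono.monotone h1
      have hib : v i ≤ v b := vmono.monotone h2
      rw [← vmod s hs, ← vmod s hs] at h3
      have hdvd : 2 ^ s ∣ v i - v a := (Nat.modEq_iff_dvd' hai).1 h3.symm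
      obtain ⟨l, hl⟩ := hdvd
      refine ⟨l, ?_, ?_⟩
      · apply Nat.lt_succ_of_le
        rw [Nat.le_div_iff_mul_le hpos, mul_comm, ← hl]
        omega
      · have : v i = v a + l * 2 ^ s := by rw [mul_comm, ← hl]; omega
        exact_mod_cast this
  refine ⟨v a, s, (v b - v a) / 2 ^ s + 1, Nat.le_add_left _ _, ?_, ?_⟩
  · rw [hset, Set.ncard_coe_finset, Finset.card_image_of_injective]
    · exact hcard
    · intro i j hij
      have hij' : (v i : ℤ) = v j := hij
      exact vmono.injective (by exact_mod_cast hij')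
  · rw [hset]
    have key : ∀ x ∈ (((Finset.univ.filter
        (fun i => a ≤ i ∧ i ≤ b ∧ g i % 2 ^ s = g a % 2 ^ s)).image
        (fun i => (v i : ℤ)) : Finset ℤ) : Set ℤ), χ x = χ (v a) := by
      intro x hx
      simp only [Finset.coe_image, Set.mem_image, Finset.mem_coe, Finset.mem_filter,
        Finset.mem_univ, true_and] at hx
      obtain ⟨i, ⟨h1, h2, h3⟩, rfl⟩ := hx
      exact hmono i h1 h2 h3
    intro x hx y hy
    rw [key x hx, key y hy]
end

section
/- For any positive integers c and k, there exists a finite set P of points in ℝ² with the following property: for every coloring χ : P → {1,...,c}, there exist points p₀, p₁, ..., p_k in P, all of the same color, such that for each i ∈ {1,...,k} one has p_{i−1} ≺ p_i and {p_{i−1}, p_i} is an edge of the Hasse diagram of (P, ≺). (That is, the Hasse diagram of the 2-dimensional poset P contains a monochromatic increasing path of length k.) -/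
/-- Strict dominance order on the plane: `p ≺ q` iff both coordinates of `p` are
strictly smaller than those of `q`. -/
def StrictDom (p q : ℝ × ℝ) : Prop := p.1 < q.1 ∧ p.2 < q.2

/-- `{p, q}` with `p ≺ q` is an edge of the Hasse diagram of `(P, ≺)` if no `w ∈ P`
lies strictly between `p` and `q`. -/
def HasseEdge (P : Finset (ℝ × ℝ)) (p q : ℝ × ℝ) : Prop :=
  StrictDom p q ∧ ¬∃ w ∈ P, StrictDom p w ∧ StrictDom w q


namespace HasseAux

/-- Dominance for abstract points with integer coordinates. -/
def Dom {α : Type} (x y : α → ℤ) (p q : α) : Prop := x p < x q ∧ y p < y q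

/-- Covering relation. -/
def Edge {α : Type} (x y : α → ℤ) (p q : α) : Prop :=
  Dom x y p q ∧ ∀ w, ¬ (Dom x y p w ∧ Dom x y w q)

/-- `p` is a maximal point among those of height at most that of `a`. -/
def Vis {α : Type} (x y : α → ℤ) (a p : α) : Prop :=
  y p ≤ y a ∧ ∀ w, y w ≤ y a → ¬ Dom x y p w

/-- Every proper coloring sees `c` colors from some height. -/
def Good (c : ℕ) : Prop :=
  ∃ (α : Type) (_ : Fintype α) (x y : α → ℤ), Function.Injective x ∧ Function.Injective y ∧
    ∀ χ : α → ℕ, (∀ p q, Edge x y p q → χ p ≠ χ q) →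
      ∃ a, ∃ S : Finset ℕ, S.card = c ∧ ∀ s ∈ S, ∃ p, Vis x y a p ∧ χ p = s

/-- Any finite family of values in a linear order can be replaced by integers. -/
lemma compress {α L : Type} [Fintype α] [LinearOrder L] (x : α → L) :
    ∃ f : α → ℤ, ∀ a b, f a < f b ↔ x a < x b := by
  classical
  have mono : ∀ a b, x a ≤ x b → (Finset.univ.filter fun u => x u < x a) ⊆
      (Finset.univ.filter fun u => x u < x b) := by
    intro a b h u hu
    simp only [Finset.mem_filter, Finset.mem_univ, true_and] at hu ⊢
    exact lt_of_lt_of_le hu h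
  refine ⟨fun a => ((Finset.univ.filter fun u => x u < x a).card : ℤ), fun a b => ?_⟩
  constructor
  · intro h
    by_contra hn
    have := Finset.card_le_card (mono b a (not_lt.mp hn))
    simp only at h
    omega
  · intro h
    have : (Finset.univ.filter fun u => x u < x a).card <
        (Finset.univ.filter fun u => x u < x b).card := by
      apply Finset.card_lt_card
      refine ⟨mono a b h.le, fun hs => ?_⟩
      have : a ∈ Finset.univ.filter fun u => x u < x a := hs (by simp [h])
      simp at this
    simp only
    exact_mod_cast this

lemma compress3 {α : Type} [Fintype α] (u v w : α → ℤ) :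
    ∃ f : α → ℤ, ∀ a b, f a < f b ↔
      (u a < u b ∨ u a = u b ∧ (v a < v b ∨ v a = v b ∧ w a < w b)) := by
  obtain ⟨f, hf⟩ := compress (fun a => toLex (u a, toLex (v a, w a)))
  refine ⟨f, fun a b => ?_⟩
  rw [hf]
  simp [Prod.Lex.toLex_lt_toLex]

lemma good_one : Good 1 := by
  refine ⟨Unit, inferInstance, fun _ => 0, fun _ => 0, fun _ _ _ => rfl, fun _ _ _ => rfl, ?_⟩
  intro χ _
  refine ⟨(), {χ ()}, by simp, ?_⟩
  intro s hs
  refine ⟨(), ⟨le_refl _, ?_⟩, (Finset.mem_singleton.mp hs).symm⟩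
  intro w _ h
  exact absurd h.1 (by simp)

lemma good_succ (c : ℕ) (h : Good c) : Good (c + 1) := by
  classical
  obtain ⟨α, _, x, y, hx, hy, H⟩ := h
  obtain ⟨X, hX⟩ := compress3 (α := α ⊕ (α × (α ⊕ α)))
    (Sum.elim x (fun t => x t.1))
    (Sum.elim (fun _ => 2) (fun t => Sum.elim (fun _ => 0) (fun _ => 1) t.2))
    (Sum.elim (fun _ => 0) (fun t => Sum.elim x (fun q => - y q) t.2))
  obtain ⟨Y, hY⟩ := compress3 (α := α ⊕ (α × (α ⊕ α)))
    (Sum.elim y (fun t => y t.1))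
    (Sum.elim (fun _ => 0) (fun _ => 1))
    (Sum.elim (fun _ => 0) (fun t => Sum.elim (fun q => 2 * y q) (fun q => 2 * y q + 1) t.2))
  have ix : ∀ a b, x a = x b → a = b := fun a b h => hx h
  have iy : ∀ a b, y a = y b → a = b := fun a b h => hy h
  have cx : ∀ a b, a = b → x a = x b := fun a b h => by rw [h]
  have cy : ∀ a b, a = b → y a = y b := fun a b h => by rw [h]
  have key : ∀ a b, x a = x b ↔ y a = y b := fun a b => by rw [hx.eq_iff, hy.eq_iff]
  have injX : Function.Injective X := by
    intro s t hst
    have h1 := (hX s t).not.mp (by omega)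
    have h2 := (hX t s).not.mp (by omega)
    rcases s with a | ⟨a, q | q⟩ <;> rcases t with b | ⟨b, r | r⟩ <;>
      simp only [Sum.elim_inl, Sum.elim_inr] at h1 h2
    · have e0 : x a = x b := by omega
      rw [ix a b e0]
    · have e0 : x a = x b := by omega
      simp [e0] at h1 h2
    · have e0 : x a = x b := by omega
      simp [e0] at h1 h2
    · have e0 : x a = x b := by omega
      simp [e0] at h1 h2
    · have e0 : x a = x b := by omega
      have e1 : x q = x r := by
        simp [e0] at h1 h2
        omega
      rw [ix a b e0, ix q r e1]
    · have e0 : x a = x b := by omega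
      simp [e0] at h1 h2
    · have e0 : x a = x b := by omega
      simp [e0] at h1 h2
    · have e0 : x a = x b := by omega
      simp [e0] at h1 h2
    · have e0 : x a = x b := by omega
      have e1 : y q = y r := by
        simp [e0] at h1 h2
        omega
      rw [ix a b e0, iy q r e1]
  have injY : Function.Injective Y := by
    intro s t hst
    have h1 := (hY s t).not.mp (by omega)
    have h2 := (hY t s).not.mp (by omega)
    rcases s with a | ⟨a, q | q⟩ <;> rcases t with b | ⟨b, r | r⟩ <;>
      simp only [Sum.elim_inl, Sum.elim_inr] at h1 h2
    · have e0 : y a = y b := by omega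
      rw [iy a b e0]
    · have e0 : y a = y b := by omega
      simp [e0] at h1 h2
    · have e0 : y a = y b := by omega
      simp [e0] at h1 h2
    · have e0 : y a = y b := by omega
      simp [e0] at h1 h2
    · have e0 : y a = y b := by omega
      have e1 : y q = y r := by
        simp [e0] at h1 h2
        omega
      rw [iy a b e0, iy q r e1]
    · have e0 : y a = y b := by omega
      simp [e0] at h1 h2
      omega
    · have e0 : y a = y b := by omega
      simp [e0] at h1 h2
    · have e0 : y a = y b := by omega
      simp [e0] at h1 h2
      omega
    · have e0 : y a = y b := by omega
      have e1 : y q = y r := by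
        simp [e0] at h1 h2
        omega
      rw [iy a b e0, iy q r e1]
  refine ⟨α ⊕ (α × (α ⊕ α)), inferInstance, X, Y, injX, injY, ?_⟩
  intro χ hχ
  -- outer edges survive
  have outer : ∀ p q, Edge x y p q → Edge X Y (Sum.inl p) (Sum.inl q) := by
    rintro p q ⟨⟨h1, h2⟩, h3⟩
    refine ⟨⟨(hX _ _).mpr (by simp; omega), (hY _ _).mpr (by simp; omega)⟩, ?_⟩
    rintro w ⟨⟨w1, w2⟩, ⟨w3, w4⟩⟩
    rw [hX] at w1 w3
    rw [hY] at w2 w4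
    rcases w with b | ⟨b, r | r⟩ <;>
      simp only [Sum.elim_inl, Sum.elim_inr] at w1 w2 w3 w4 <;>
      refine h3 b ⟨⟨?_, ?_⟩, ⟨?_, ?_⟩⟩ <;>
      have k1 := key p b <;> have k2 := key b q <;> omega
  -- inner edges survive
  have inner : ∀ a p q, Edge x y p q →
      Edge X Y (Sum.inr (a, Sum.inl p)) (Sum.inr (a, Sum.inl q)) := by
    rintro a p q ⟨⟨h1, h2⟩, h3⟩
    refine ⟨⟨(hX _ _).mpr (by simp; omega), (hY _ _).mpr (by simp; omega)⟩, ?_⟩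
    rintro w ⟨⟨w1, w2⟩, ⟨w3, w4⟩⟩
    rw [hX] at w1 w3
    rw [hY] at w2 w4
    rcases w with b | ⟨b, r | r⟩ <;>
      simp only [Sum.elim_inl, Sum.elim_inr] at w1 w2 w3 w4
    · omega
    · refine h3 r ⟨⟨?_, ?_⟩, ⟨?_, ?_⟩⟩ <;> omega
    · omega
  -- the extra points see what is visible at their height
  have extra : ∀ a b p, Vis x y b p →
      Edge X Y (Sum.inr (a, Sum.inl p)) (Sum.inr (a, Sum.inr b)) := by
    rintro a b p ⟨h1, h2⟩
    refine ⟨⟨(hX _ _).mpr (by simp), (hY _ _).mpr (by simp; omega)⟩, ?_⟩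
    rintro w ⟨⟨w1, w2⟩, ⟨w3, w4⟩⟩
    rw [hX] at w1 w3
    rw [hY] at w2 w4
    rcases w with d | ⟨d, r | r⟩ <;>
      simp only [Sum.elim_inl, Sum.elim_inr] at w1 w2 w3 w4
    · omega
    · refine h2 r ?_ ⟨?_, ?_⟩ <;> omega
    · omega
  obtain ⟨a, S, hS, hSv⟩ := H (fun p => χ (Sum.inl p)) (fun p q e => hχ _ _ (outer p q e))
  obtain ⟨q, hq⟩ : ∃ q, χ (Sum.inr (a, q)) ∉ S := by
    by_contra hn
    push Not at hn
    obtain ⟨b, T, hT, hTv⟩ := H (fun p => χ (Sum.inr (a, Sum.inl p)))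
      (fun p q e => hχ _ _ (inner a p q e))
    have hTS : T = S := by
      apply Finset.eq_of_subset_of_card_le
      · intro t ht
        obtain ⟨p, _, rfl⟩ := hTv t ht
        exact hn _
      · omega
    obtain ⟨p, hp, he⟩ := hTv _ (hTS ▸ hn (Sum.inr b))
    exact hχ _ _ (extra a b p hp) he
  refine ⟨Sum.inr (a, q), insert (χ (Sum.inr (a, q))) S, by
    rw [Finset.card_insert_of_notMem hq, hS], ?_⟩
  intro s hs
  rcases Finset.mem_insert.mp hs with rfl | hs
  · refine ⟨Sum.inr (a, q), ⟨le_refl _, ?_⟩, rfl⟩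
    rintro w hw ⟨_, h2⟩
    omega
  · obtain ⟨p, ⟨h1, h2⟩, rfl⟩ := hSv s hs
    refine ⟨Sum.inl p, ⟨?_, ?_⟩, rfl⟩
    · refine le_of_lt ((hY _ _).mpr ?_)
      simp
      omega
    · rintro w hw ⟨w1, w2⟩
      have hw := (hY _ _).not.mp (not_lt.mpr hw)
      rw [hX] at w1
      rw [hY] at w2
      rcases w with d | ⟨d, r | r⟩ <;>
        simp only [Sum.elim_inl, Sum.elim_inr] at w1 w2 hw <;>
        have k1 := key p d <;>
        refine h2 d ?_ ⟨?_, ?_⟩ <;> omega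

lemma good_all (n : ℕ) : Good (n + 1) := by
  induction n with
  | zero => exact good_one
  | succ n ih => exact good_succ _ ih

/-- `p` is the end of a monochromatic path of length `n`. -/
def PathEnd {c : ℕ} (P : Finset (ℝ × ℝ)) (χ : ℝ × ℝ → Fin c) : ℕ → ℝ × ℝ → Prop
  | 0, p => p ∈ P
  | n + 1, p => p ∈ P ∧ ∃ q, PathEnd P χ n q ∧ HasseEdge P q p ∧ χ q = χ p

lemma PathEnd.extract {c : ℕ} {P : Finset (ℝ × ℝ)} {χ : ℝ × ℝ → Fin c} :
    ∀ (n : ℕ) (p : ℝ × ℝ), PathEnd P χ n p → ∃ f : ℕ → ℝ × ℝ, f n = p ∧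
      (∀ i ≤ n, f i ∈ P) ∧ (∀ i ≤ n, χ (f i) = χ p) ∧ ∀ i < n, HasseEdge P (f i) (f (i + 1)) := by
  intro n
  induction n with
  | zero =>
    intro p hp
    exact ⟨fun _ => p, rfl, fun _ _ => hp, fun _ _ => rfl, fun i hi => absurd hi (by omega)⟩
  | succ n ih =>
    rintro p ⟨hp, q, hq, he, hc⟩
    obtain ⟨f, f1, f2, f3, f4⟩ := ih q hq
    refine ⟨fun i => if i ≤ n then f i else p, by simp, ?_, ?_, ?_⟩
    · intro i _
      by_cases h : i ≤ n
      · simpa [h] using f2 i h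
      · simpa [h] using hp
    · intro i _
      by_cases h : i ≤ n
      · simpa [h, hc] using f3 i h
      · simp [h]
    · intro i hi
      by_cases h : i + 1 ≤ n
      · have h' : i ≤ n := by omega
        simpa [h, h'] using f4 i h
      · have h' : i = n := by omega
        subst h'
        simpa [f1] using he

end HasseAux

/-- For any positive integers `c, k`, there exists a finite planar point set `P` (a
2-dimensional poset under dominance) such that every `c`-coloring of the plane admits a
monochromatic increasing path `p 0 ≺ p 1 ≺ ⋯ ≺ p k` of length `k` in the Hasse diagram
of `(P, ≺)`. -/
theorem statement8 (c k : ℕ) (hc : 0 < c) (hk : 0 < k) :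
    ∃ P : Finset (ℝ × ℝ), ∀ χ : ℝ × ℝ → Fin c,
      ∃ p : Fin (k + 1) → ℝ × ℝ,
        (∀ i, p i ∈ P) ∧
        (∀ i j, χ (p i) = χ (p j)) ∧
        ∀ i : Fin k, HasseEdge P (p i.castSucc) (p i.succ) := by
  classical
  obtain ⟨α, _, x, y, hx, hy, H⟩ := HasseAux.good_all (c * k)
  let e : α → ℝ × ℝ := fun a => ((x a : ℝ), (y a : ℝ))
  have hdom : ∀ a b, StrictDom (e a) (e b) ↔ HasseAux.Dom x y a b := by
    intro a b
    simp [StrictDom, HasseAux.Dom, e]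
  have hedge : ∀ a b, HasseAux.Edge x y a b → HasseEdge (Finset.univ.image e) (e a) (e b) := by
    rintro a b ⟨h1, h2⟩
    refine ⟨(hdom _ _).mpr h1, ?_⟩
    rintro ⟨w, hw, w1, w2⟩
    obtain ⟨d, _, rfl⟩ := Finset.mem_image.mp hw
    exact h2 d ⟨(hdom _ _).mp w1, (hdom _ _).mp w2⟩
  refine ⟨Finset.univ.image e, fun χ => ?_⟩
  by_cases hex : ∃ p, HasseAux.PathEnd (Finset.univ.image e) χ k p
  · obtain ⟨p, hp⟩ := hex
    obtain ⟨f, _, f2, f3, f4⟩ := HasseAux.PathEnd.extract k p hp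
    refine ⟨fun i => f i, fun i => f2 i (by omega), fun i j => ?_, fun i => ?_⟩
    · rw [f3 i (by omega), f3 j (by omega)]
    · simpa using f4 i i.2
  · exfalso
    let l : ℝ × ℝ → ℕ := fun p =>
      Nat.findGreatest (fun n => HasseAux.PathEnd (Finset.univ.image e) χ n p) k
    have hl : ∀ a, HasseAux.PathEnd (Finset.univ.image e) χ (l (e a)) (e a) := by
      intro a
      exact Nat.findGreatest_spec (P := fun n => HasseAux.PathEnd (Finset.univ.image e) χ n (e a))
        (Nat.zero_le k) (by simp [HasseAux.PathEnd])
    have hlk : ∀ a, l (e a) < k := by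
      intro a
      refine lt_of_le_of_ne (Nat.findGreatest_le k) fun h => hex ⟨e a, ?_⟩
      have := hl a
      rwa [h] at this
    obtain ⟨a, S, hS, hSv⟩ := H (fun a => l (e a) + k * (χ (e a)).val) (by
      intro p q hpq heq
      have e1 : l (e p) = l (e q) := by
        have := congrArg (· % k) heq
        simpa [Nat.add_mul_mod_self_left, Nat.mod_eq_of_lt (hlk _)] using this
      have e2 : (χ (e p)) = (χ (e q)) := by
        rw [e1] at heq
        exact Fin.ext (Nat.eq_of_mul_eq_mul_left hk (by omega))
      have h1 : HasseAux.PathEnd (Finset.univ.image e) χ (l (e p) + 1) (e q) :=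
        ⟨by simp, e p, hl p, hedge p q hpq, e2⟩
      have h2 : l (e p) + 1 ≤ l (e q) := Nat.le_findGreatest (hlk p) h1
      omega)
    have hsub : S ⊆ Finset.range (c * k) := by
      intro s hs
      obtain ⟨p, _, rfl⟩ := hSv s hs
      have h1 := hlk p
      have h2 := (χ (e p)).2
      have h3 : k * ((χ (e p)).val + 1) ≤ k * c := Nat.mul_le_mul_left k h2
      rw [Finset.mem_range, mul_comm c k]
      rw [Nat.mul_add] at h3
      omega
    have := Finset.card_le_card hsub
    rw [hS, Finset.card_range] at this
    omega
end

section
/- For any positive integers c and g, there exists a finite simple graph G with girth at least g and chromatic number at least c + 1. -/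
open Finset in
theorem erdos_cnt {α β : Type} [Fintype α] [Fintype β] [DecidableEq α] [DecidableEq β]
    (E : Finset α) (A : Finset β) :
    ((univ.filter fun f : α → β => ∀ e ∈ E, f e ∈ A).card) * (Fintype.card β) ^ E.card
      = A.card ^ E.card * Fintype.card β ^ Fintype.card α := by
  have h : (univ.filter fun f : α → β => ∀ e ∈ E, f e ∈ A)
      = Fintype.piFinset (fun e => if e ∈ E then A else univ) := by
    ext f
    simp only [mem_filter, mem_univ, true_and, Fintype.mem_piFinset]
    refine forall_congr' fun e => ?_
    by_cases he : e ∈ E <;> simp [he]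
  rw [h, Fintype.card_piFinset]
  have h2 : ∀ e, (if e ∈ E then A else univ : Finset β).card
      = if e ∈ E then A.card else Fintype.card β := by
    intro e; split_ifs <;> simp
  simp only [h2]
  rw [Finset.prod_ite]
  simp only [prod_const, filter_mem_eq_inter, univ_inter]
  rw [mul_assoc, ← pow_add]
  congr 2
  have : (univ.filter fun x => x ∉ E) = Eᶜ := by ext; simp
  rw [this, card_compl]
  have := card_le_univ E
  omega

open Finset in
theorem erdos_walks {V : Type} [Fintype V] [DecidableEq V] (l : ℕ) (u v : V) :
    ((⊤ : SimpleGraph V).finsetWalkLength (l + 1) u v).card ≤ Fintype.card V ^ l := by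
  rw [← SimpleGraph.card_set_walk_length_eq]
  have h := SimpleGraph.adjMatrix_pow_apply_eq_card_walk (G := (⊤ : SimpleGraph V)) (α := ℕ) (l + 1) u v
  simp only [Nat.cast_id] at h
  rw [← h]
  clear h
  induction l generalizing u v with
  | zero => simp [SimpleGraph.adjMatrix_apply]; split_ifs <;> simp
  | succ l ih =>
    rw [pow_succ, Matrix.mul_apply]
    calc _ ≤ ∑ w : V, Fintype.card V ^ l * 1 := by
          refine sum_le_sum fun w _ => Nat.mul_le_mul (ih u w) ?_
          rw [SimpleGraph.adjMatrix_apply]; split_ifs <;> simp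
      _ = _ := by simp [pow_succ']

/-- The graph attached to a colouring of the pairs with `k` colours. -/
def erdosGraph {N k : ℕ} (f : Sym2 (Fin N) → Fin k) : SimpleGraph (Fin N) :=
  SimpleGraph.fromEdgeSet {e | (f e : ℕ) = 0}

/-- The vertex `a` lies at the base of a short cycle. -/
def erdosBad {N k : ℕ} (g : ℕ) (f : Sym2 (Fin N) → Fin k) (a : Fin N) : Prop :=
  ∃ w : (erdosGraph f).Walk a a, w.IsCycle ∧ w.length ≤ g

open Finset in
open Classical in
theorem erdos_bad {N k g : ℕ} (hk : 0 < k) (a : Fin N) :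
    ((univ.filter fun f : Sym2 (Fin N) → Fin k => erdosBad g f a).card : ℝ)
      ≤ ∑ l ∈ range g, (N : ℝ) ^ l * ((k : ℝ) ^ Fintype.card (Sym2 (Fin N)) / (k : ℝ) ^ (l + 1)) := by
  set W : ℕ → Finset ((⊤ : SimpleGraph (Fin N)).Walk a a) := fun l =>
    (SimpleGraph.finsetWalkLength ⊤ (l + 1) a a).filter fun w => w.IsTrail with hW
  set A : Finset (Fin k) := univ.filter fun i => (i : ℕ) = 0 with hA
  have hAc : A.card = 1 := by
    rw [card_eq_one]
    refine ⟨⟨0, hk⟩, ?_⟩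
    ext i; simp [hA, Fin.ext_iff]
  have hsub : (univ.filter fun f : Sym2 (Fin N) → Fin k => erdosBad g f a) ⊆
      (range g).biUnion fun l => (W l).biUnion fun w =>
        univ.filter fun f : Sym2 (Fin N) → Fin k => ∀ e ∈ w.edges.toFinset, f e ∈ A := by
    intro f hf
    simp only [mem_filter, mem_univ, true_and] at hf
    obtain ⟨w, hw, hwl⟩ := hf
    have h3 := hw.three_le_length
    simp only [mem_biUnion, mem_range]
    refine ⟨w.length - 1, by omega, w.mapLe le_top, ?_, ?_⟩
    · simp only [hW, mem_filter, SimpleGraph.mem_finsetWalkLength_iff]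
      refine ⟨by rw [SimpleGraph.Walk.length_mapLe]; omega, ?_⟩
      exact (hw.mapLe le_top).isTrail
    · simp only [mem_filter, mem_univ, true_and, List.mem_toFinset]
      intro e he
      rw [SimpleGraph.Walk.edges_mapLe_eq_edges] at he
      have := w.edges_subset_edgeSet he
      simp only [erdosGraph, SimpleGraph.edgeSet_fromEdgeSet] at this
      simpa [hA] using this.1
  have hle := (card_le_card hsub).trans card_biUnion_le
  have hle' : ((univ.filter fun f : Sym2 (Fin N) → Fin k => erdosBad g f a).card : ℝ) ≤ _ :=
    Nat.cast_le.2 hle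
  refine hle'.trans ?_
  push_cast
  refine sum_le_sum fun l _ => ?_
  refine (Nat.cast_le.2 card_biUnion_le).trans ?_
  push_cast
  have hkk : (0 : ℝ) < k := by exact_mod_cast hk
  calc _ ≤ ∑ w ∈ W l, ((k : ℝ) ^ Fintype.card (Sym2 (Fin N)) / (k : ℝ) ^ (l + 1)) := by
        refine sum_le_sum fun w hw => le_of_eq ?_
        simp only [hW, mem_filter, SimpleGraph.mem_finsetWalkLength_iff] at hw
        have hc : w.edges.toFinset.card = l + 1 := by
          rw [List.toFinset_card_of_nodup hw.2.edges_nodup, SimpleGraph.Walk.length_edges, hw.1]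
        have := erdos_cnt w.edges.toFinset A
        rw [hc, hAc, one_pow, one_mul, Fintype.card_fin] at this
        rw [eq_div_iff (by positivity)]
        exact_mod_cast this
    _ = (W l).card * ((k : ℝ) ^ Fintype.card (Sym2 (Fin N)) / (k : ℝ) ^ (l + 1)) := by
        rw [sum_const, nsmul_eq_mul]
    _ ≤ _ := by
        gcongr
        have h1 : (W l).card ≤ Fintype.card (Fin N) ^ l := by
          rw [hW]
          refine (card_filter_le _ _).trans ?_
          convert erdos_walks l a a
        rw [Fintype.card_fin] at h1
        exact_mod_cast h1

open Finset in
open Classical in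
theorem erdos_ind {N k : ℕ} (hk : 0 < k) (S : Finset (Fin N)) :
    ((univ.filter fun f : Sym2 (Fin N) → Fin k => (erdosGraph f).IsIndepSet S).card : ℝ)
      ≤ (k : ℝ) ^ Fintype.card (Sym2 (Fin N)) * (((k : ℝ) - 1) / k) ^ (S.card.choose 2) := by
  set A : Finset (Fin k) := univ.filter fun i => (i : ℕ) ≠ 0 with hA
  have hAc : A.card = k - 1 := by
    have : A = univ.erase ⟨0, hk⟩ := by
      ext i; simp [hA, Fin.ext_iff]
    rw [this, card_erase_of_mem (mem_univ _)]; simp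
  set E := S.offDiag.image (Function.uncurry Sym2.mk) with hE
  have hEc : E.card = S.card.choose 2 := Sym2.card_image_offDiag S
  have hsub : (univ.filter fun f : Sym2 (Fin N) → Fin k => (erdosGraph f).IsIndepSet S) ⊆
      univ.filter fun f : Sym2 (Fin N) → Fin k => ∀ e ∈ E, f e ∈ A := by
    intro f hf
    simp only [mem_filter, mem_univ, true_and] at hf ⊢
    intro e he
    simp only [hE, mem_image, mem_offDiag] at he
    obtain ⟨⟨x, y⟩, ⟨hx, hy, hxy⟩, rfl⟩ := he
    have := hf hx hy hxy
    simpa [erdosGraph, hA, hxy] using this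
  have hkk : (0 : ℝ) < k := by exact_mod_cast hk
  have h := erdos_cnt E A
  rw [hEc, hAc, Fintype.card_fin] at h
  have h' : ((#{f : Sym2 (Fin N) → Fin k | ∀ e ∈ E, f e ∈ A} : ℕ) : ℝ) * (k:ℝ) ^ (S.card.choose 2)
      = ((k : ℝ) - 1) ^ (S.card.choose 2) * (k : ℝ) ^ Fintype.card (Sym2 (Fin N)) := by
    have := congrArg (Nat.cast (R := ℝ)) h
    push_cast [Nat.cast_sub (show 1 ≤ k from hk)] at this
    exact this
  refine (Nat.cast_le.2 (card_le_card hsub)).trans (le_of_eq ?_)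
  rw [div_pow, ← mul_div_assoc, eq_div_iff (by positivity), h']
  ring

theorem erdos_half {k : ℕ} (hk : 2 ≤ k) : (((k : ℝ) - 1) / k) ^ k ≤ 1 / 2 := by
  have hkk : (2 : ℝ) ≤ k := by exact_mod_cast hk
  have h := one_add_mul_le_pow (a := (1 : ℝ) / ((k : ℝ) - 1)) (by
    have : (0:ℝ) ≤ 1 / ((k : ℝ) - 1) := by apply div_nonneg <;> linarith
    linarith) k
  have h1 : (1 : ℝ) + 1 / (k - 1) = k / (k - 1) := by
    have : (k : ℝ) - 1 ≠ 0 := by linarith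
    field_simp; ring
  have h2 : (1 : ℝ) ≤ k * (1 / (k - 1)) := by
    rw [mul_one_div, le_div_iff₀] <;> linarith
  rw [h1] at h
  have h3 : ((k : ℝ) - 1) / k = ((k : ℝ) / ((k : ℝ) - 1))⁻¹ := by rw [inv_div]
  rw [h3, inv_pow, one_div]
  apply inv_anti₀ (by norm_num)
  linarith

open Finset in
open Classical in
theorem erdos_exists {N k g d s : ℕ} (hk : 2 ≤ k) (hN : N = d * k) (hd : 1 ≤ d)
    (hNg : 8 * (g * d ^ g) ≤ N) (hs : k * (N + 1) ≤ s.choose 2) :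
    ∃ f : Sym2 (Fin N) → Fin k, 2 * (univ.filter fun a => erdosBad g f a).card < N ∧
      ∀ S : Finset (Fin N), S.card = s → ¬ (erdosGraph f).IsIndepSet S := by
  by_contra! hcon
  set Q : ℝ := (k : ℝ) ^ Fintype.card (Sym2 (Fin N)) with hQ
  have hkk : (0 : ℝ) < k := by exact_mod_cast (by omega : 0 < k)
  have hQ0 : 0 < Q := by positivity
  have hNpos : 0 < N := by rw [hN]; positivity
  set B : Finset (Sym2 (Fin N) → Fin k) :=
    univ.filter fun f => N ≤ 2 * (univ.filter fun a => erdosBad g f a).card with hB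
  set I : Finset (Sym2 (Fin N) → Fin k) :=
    (univ.filter fun S : Finset (Fin N) => S.card = s).biUnion fun S =>
      univ.filter fun f => (erdosGraph f).IsIndepSet S with hI
  have hcov : (univ : Finset (Sym2 (Fin N) → Fin k)) ⊆ B ∪ I := by
    intro f _
    rw [mem_union]
    by_cases h : N ≤ 2 * (univ.filter fun a => erdosBad g f a).card
    · left; simp [hB, h]
    · right
      obtain ⟨S, hS, hi⟩ := hcon f (by omega)
      simp only [hI, mem_biUnion, mem_filter, mem_univ, true_and]
      exact ⟨S, hS, hi⟩
  have hcard : Q ≤ (B.card : ℝ) + I.card := by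
    have := (card_le_card hcov).trans (card_union_le _ _)
    rw [card_univ, Fintype.card_fun, Fintype.card_fin] at this
    rw [hQ]; exact_mod_cast this
  have hIc : (I.card : ℝ) ≤ Q / 2 := by
    have h1 : (I.card : ℝ) ≤ _ := Nat.cast_le.2 card_biUnion_le
    push_cast at h1
    refine h1.trans ?_
    have hr0 : 0 ≤ ((k : ℝ) - 1) / k := by
      apply div_nonneg _ hkk.le
      have : (2 : ℝ) ≤ k := by exact_mod_cast hk
      linarith
    have hr1 : ((k : ℝ) - 1) / k ≤ 1 := by
      rw [div_le_one hkk]; linarith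
    have hp : (((k : ℝ) - 1) / k) ^ (s.choose 2) ≤ (1 / 2) ^ (N + 1) := by
      calc _ ≤ (((k : ℝ) - 1) / k) ^ (k * (N + 1)) := pow_le_pow_of_le_one hr0 hr1 hs
        _ = ((((k : ℝ) - 1) / k) ^ k) ^ (N + 1) := pow_mul _ _ _
        _ ≤ _ := by
          have := erdos_half hk
          gcongr
    calc _ ≤ ∑ S ∈ univ.filter (fun S : Finset (Fin N) => S.card = s), Q * (1 / 2) ^ (N + 1) := by
          refine sum_le_sum fun S hS => (erdos_ind (by omega) S).trans ?_
          simp only [mem_filter, mem_univ, true_and] at hS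
          rw [hS]
          gcongr
      _ = #(univ.filter (fun S : Finset (Fin N) => S.card = s)) * (Q * (1 / 2) ^ (N + 1)) := by
          rw [sum_const, nsmul_eq_mul]
      _ ≤ 2 ^ N * (Q * (1 / 2) ^ (N + 1)) := by
          gcongr
          have := card_filter_le (univ : Finset (Finset (Fin N))) (fun S => S.card = s)
          rw [card_univ, Fintype.card_finset, Fintype.card_fin] at this
          exact_mod_cast this
      _ = Q / 2 := by
          rw [one_div, inv_pow, pow_succ]
          field_simp
  have hBc : (B.card : ℝ) * N ≤ 2 * (Q * (g * d ^ g)) := by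
    have hd1 : B.card * N ≤ 2 * ∑ a : Fin N, (univ.filter fun f : Sym2 (Fin N) → Fin k =>
        erdosBad g f a).card := by
      calc B.card * N = ∑ f ∈ B, N := by simp
        _ ≤ ∑ f ∈ B, 2 * (univ.filter fun a => erdosBad g f a).card := by
          refine sum_le_sum fun f hf => ?_
          simpa [hB] using hf
        _ ≤ ∑ f : Sym2 (Fin N) → Fin k, 2 * (univ.filter fun a => erdosBad g f a).card :=
          sum_le_univ_sum_of_nonneg fun _ => Nat.zero_le _
        _ = _ := by
          rw [← mul_sum]
          congr 1
          exact sum_card_bipartiteAbove_eq_sum_card_bipartiteBelow _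
    have hd2 : (B.card : ℝ) * N ≤ 2 * ∑ a : Fin N, ((univ.filter fun f : Sym2 (Fin N) → Fin k =>
        erdosBad g f a).card : ℝ) := by exact_mod_cast hd1
    refine hd2.trans ?_
    gcongr
    calc _ ≤ ∑ a : Fin N, ∑ l ∈ range g, (N : ℝ) ^ l * (Q / (k : ℝ) ^ (l + 1)) :=
          sum_le_sum fun a _ => erdos_bad (by omega) a
      _ = ∑ l ∈ range g, Q * (d : ℝ) ^ (l + 1) := by
          rw [sum_const, card_univ, Fintype.card_fin, nsmul_eq_mul, mul_sum]
          refine sum_congr rfl fun l _ => ?_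
          have : (N : ℝ) = d * k := by exact_mod_cast hN
          rw [this]
          field_simp
          rw [mul_pow]; ring
      _ ≤ ∑ l ∈ range g, Q * (d : ℝ) ^ g := by
          refine sum_le_sum fun l hl => ?_
          have hd' : (1 : ℝ) ≤ d := by exact_mod_cast hd
          have := mem_range.1 hl
          gcongr
          omega
      _ = _ := by
          rw [sum_const, card_range, nsmul_eq_mul]; ring
  have hNg' : 8 * ((g : ℝ) * d ^ g) ≤ N := by exact_mod_cast hNg
  have hN0 : (0 : ℝ) < N := by exact_mod_cast hNpos
  have h4 : (B.card : ℝ) * N ≤ (Q / 4) * N := by nlinarith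
  have h5 : (B.card : ℝ) ≤ Q / 4 := le_of_mul_le_mul_right h4 hN0
  linarith

open Finset in
open Classical in
theorem erdos_main (c g : ℕ) (hc : 2 ≤ c) :
    ∃ (n : ℕ) (G : SimpleGraph (Fin n)), ¬ G.Colorable c ∧ (g : ℕ∞) ≤ G.egirth := by
  set d := 32 * c ^ 2 with hd
  set t := 8 * (g * d ^ g) + 1 with ht
  have ht1 : 1 ≤ t := by omega
  set k := 2 * c * t with hk
  set N := d * k with hN
  set s := d * t with hs
  have hd1 : 1 ≤ d := by rw [hd]; nlinarith
  have hk2 : 2 ≤ k := by rw [hk]; nlinarith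
  have hNs : N = 2 * (c * s) := by rw [hN, hs, hk]; ring
  have hs2 : 2 ≤ s := by
    have : 2 ≤ d := by rw [hd]; nlinarith
    rw [hs]; nlinarith
  obtain ⟨f, hf1, hf2⟩ := erdos_exists (N := N) (k := k) (g := g) (d := d) (s := s) hk2 hN hd1
    (by
      have : t ≤ k := by rw [hk]; nlinarith
      have : k ≤ N := by rw [hN]; nlinarith
      omega)
    (by
      rw [Nat.choose_two_right, Nat.le_div_iff_mul_le (by norm_num)]
      have h1 : s ^ 2 ≤ 2 * (s * (s - 1)) := by
        obtain ⟨r, hr⟩ : ∃ r, s = r + 2 := ⟨s - 2, by omega⟩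
        rw [hr]; simp only [show r + 2 - 1 = r + 1 by omega]
        nlinarith
      have h2 : 4 * (k * (N + 1)) ≤ s ^ 2 := by
        have e1 : s ^ 2 = 1024 * (c ^ 4 * t ^ 2) := by rw [hs, hd]; ring
        have e2 : 4 * (k * (N + 1)) = 512 * (c ^ 4 * t ^ 2) + 8 * (c * t) := by
          rw [hN, hk, hd]; ring
        have e3 : c * t ≤ c ^ 4 * t ^ 2 :=
          Nat.mul_le_mul (Nat.le_self_pow (by norm_num) c) (Nat.le_self_pow (by norm_num) t)
        omega
      omega)
  set T : Finset (Fin N) := univ.filter fun a => ¬ erdosBad g f a with hT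
  have hTc : c * s < T.card := by
    have := card_filter_add_card_filter_not (s := (univ : Finset (Fin N))) (fun a => erdosBad g f a)
    rw [card_univ, Fintype.card_fin] at this
    have h3 : #{a | erdosBad g f a} + T.card = N := by
      refine Eq.trans ?_ this
      rw [hT]
    omega
  set H := (erdosGraph f).induce (T : Set (Fin N)) with hH
  have hHc : ¬ H.Colorable c := by
    rintro ⟨C⟩
    have : NeZero c := ⟨by omega⟩
    obtain ⟨y, -, hy⟩ := exists_le_card_fiber_of_mul_le_card_of_maps_to
      (s := (univ : Finset (T : Set (Fin N)))) (t := (univ : Finset (Fin c))) (f := C) (n := s)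
      (fun _ _ => mem_univ _) univ_nonempty (by simp; omega)
    obtain ⟨U, hU, hUc⟩ := exists_subset_card_eq hy
    refine hf2 (U.map (Function.Embedding.subtype _)) (by rw [card_map, hUc]) ?_
    intro a ha b hb hab hadj
    simp only [coe_map, Set.mem_image, mem_coe] at ha hb
    obtain ⟨a, ha, rfl⟩ := ha
    obtain ⟨b, hb, rfl⟩ := hb
    have hCa := (mem_filter.1 (hU ha)).2
    have hCb := (mem_filter.1 (hU hb)).2
    exact C.valid (show H.Adj a b from hadj) (hCa.trans hCb.symm)
  have hHg : (g : ℕ∞) ≤ H.egirth := by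
    rw [SimpleGraph.le_egirth]
    intro a w hw
    by_contra hlt
    have hlt' : w.length < g := by
      rw [not_le] at hlt; exact_mod_cast hlt
    have haT : ¬ erdosBad g f a.1 := (mem_filter.1 (mem_coe.1 a.2)).2
    apply haT
    refine ⟨w.map (SimpleGraph.Embedding.induce (G := erdosGraph f) (T : Set (Fin N))).toHom, ?_, ?_⟩
    · exact hw.map (SimpleGraph.Embedding.induce (G := erdosGraph f) (T : Set (Fin N))).injective
    · exact (SimpleGraph.Walk.length_map _ _).trans_le hlt'.le
  refine ⟨_, H.overFin rfl, fun h => hHc ?_, ?_⟩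
  · exact h.of_hom (H.overFinIso rfl).toHom
  · rw [← (H.overFinIso rfl).egirth_eq]; exact hHg

/-- **Erdős.** For any positive integers `c, g`, there is a finite simple graph with
girth at least `g` and chromatic number at least `c + 1`. -/
theorem statement10 (c g : ℕ) (hc : 0 < c) (hg : 0 < g) :
    ∃ (n : ℕ) (G : SimpleGraph (Fin n)),
      (g : ℕ∞) ≤ G.girth ∧ (c + 1 : ℕ∞) ≤ G.chromaticNumber := by
  obtain ⟨n, G, hG, hgi⟩ := erdos_main (c + 2) g (by omega)
  have hac : ¬ G.IsAcyclic := fun h =>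
    hG (SimpleGraph.Colorable.mono (show 2 ≤ c + 2 by omega) h.isBipartite)
  refine ⟨n, G, ?_, ?_⟩
  · rw [SimpleGraph.girth, ENat.natCast_toNat (fun h => hac (SimpleGraph.egirth_eq_top.1 h))]
    exact hgi
  · have hcast : (c + 1 : ℕ∞) = ((c + 1 : ℕ) : ℕ∞) := by push_cast; rfl
    rw [hcast, SimpleGraph.le_chromaticNumber_iff_colorable]
    intro m hm
    have : c + 1 ≤ m := by
      by_contra hlt
      exact hG (hm.mono (by omega))
    exact_mod_cast this
end

section
/- For any positive integers c and k, there exist a finite set P of points in ℝ² and a finite family 𝓡 of axis-parallel rectangles such that: (1) for every R ∈ 𝓡, the set P ∩ R has exactly k points and is ascending, and (2) for every coloring χ : P → {1,...,c}, there is a rectangle R ∈ 𝓡 such that P ∩ R is monochromatic. -/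
/-- A set of points in the plane is ascending if no two of its points share an
`x`-coordinate and the `x`-order agrees with the `y`-order. -/
def Ascending (S : Set (ℝ × ℝ)) : Prop :=
  (∀ p ∈ S, ∀ q ∈ S, p.1 = q.1 → p = q) ∧
  ∀ p ∈ S, ∀ q ∈ S, (p.1 < q.1 ↔ p.2 < q.2)

/-- Points of the index set `V` in the box spanned by the points `a` and `b`. -/
def ptBox {V X Y : Type} [LE X] [LE Y] (x : V → X) (y : V → Y) (a b : V) : Set V :=
  {v | (x a ≤ x v ∧ x v ≤ x b) ∧ (y a ≤ y v ∧ y v ≤ y b)}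

/-- Index version of ascending sets. -/
def IdxAsc {V X Y : Type} [LE X] [LE Y] (x : V → X) (y : V → Y) (S : Set V) : Prop :=
  ∀ u ∈ S, ∀ v ∈ S, (x u ≤ x v ↔ y u ≤ y v)

/-- Some box has exactly `k` points, is ascending and monochromatic. -/
def HasMono {V X Y : Type} [LE X] [LE Y] (x : V → X) (y : V → Y) (k : ℕ) (χ : V → ℕ) : Prop :=
  ∃ a b, (ptBox x y a b).ncard = k ∧ IdxAsc x y (ptBox x y a b) ∧
    ∃ i, ∀ v ∈ ptBox x y a b, χ v = i

/-- The upper right quadrant of `a` within its level. -/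
def quadSet {V L : Type} (x y : V → ℕ) (l : V → L) (a : V) : Set V :=
  {v | l v = l a ∧ x a ≤ x v ∧ y a ≤ y v}

/-- A configuration that works for `c` colors. -/
def GProp (k c : ℕ) : Prop :=
  ∃ (W : Type) (_ : LinearOrder W) (_ : Finite W) (_ : Nonempty W) (x : W → ℕ),
    Function.Injective x ∧ ∀ C : Finset ℕ, C.card ≤ c → ∀ χ : W → ℕ, (∀ w, χ w ∈ C) →
      HasMono x (fun w : W => w) k χ

/-- A leveled configuration for `c + 1` colors with quadrants of size `m`. -/
def TProp (k c m : ℕ) : Prop :=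
  ∃ (V L : Type) (_ : Finite V) (_ : Nonempty V) (_ : LinearOrder L) (_ : Finite L)
    (x y : V → ℕ) (l : V → L),
    Function.Injective x ∧ Function.Injective y ∧ (∀ u v, y u ≤ y v → l u ≤ l v) ∧
    ∀ C : Finset ℕ, C.card ≤ c + 1 → ∀ χ : V → ℕ, (∀ v, χ v ∈ C) → ∀ i ∈ C,
      HasMono x y k χ ∨ ∃ a, (quadSet x y l a).ncard = m ∧ IdxAsc x y (quadSet x y l a) ∧
        ∀ v ∈ quadSet x y l a, χ v = i

theorem exists_rank {V X : Type} [Finite V] [LinearOrder X] (x : V → X) :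
    ∃ r : V → ℕ, ∀ u v, r u ≤ r v ↔ x u ≤ x v := by
  classical
  refine ⟨fun v => {u | x u < x v}.ncard, fun u v => ⟨fun h => ?_, fun h => ?_⟩⟩
  · by_contra hlt
    push Not at hlt
    have : {w | x w < x v}.ncard < {w | x w < x u}.ncard := by
      apply Set.ncard_lt_ncard _ (Set.toFinite _)
      refine ⟨fun w hw => lt_trans hw hlt, fun hs => ?_⟩
      exact lt_irrefl _ (hs (show v ∈ {w | x w < x u} from hlt))
    exact absurd h (not_le.mpr this)
  · exact Set.ncard_le_ncard (fun w hw => lt_of_lt_of_le hw h) (Set.toFinite _)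

theorem HasMono.transfer {V X Y V' X' Y' : Type} [LE X] [LE Y] [LE X'] [LE Y']
    {x : V → X} {y : V → Y} {x' : V' → X'} {y' : V' → Y'} {k : ℕ} {χ : V' → ℕ}
    (φ : V → V') (hφ : Function.Injective φ)
    (hx : ∀ u v, x' (φ u) ≤ x' (φ v) ↔ x u ≤ x v)
    (hy : ∀ u v, y' (φ u) ≤ y' (φ v) ↔ y u ≤ y v)
    (hc : ∀ a b v', x' (φ a) ≤ x' v' → x' v' ≤ x' (φ b) → ∃ v, φ v = v')
    (h : HasMono x y k (fun v => χ (φ v))) : HasMono x' y' k χ := by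
  obtain ⟨a, b, hcard, hasc, i, hi⟩ := h
  have key : ptBox x' y' (φ a) (φ b) = φ '' ptBox x y a b := by
    ext v'
    constructor
    · intro hv
      obtain ⟨v, rfl⟩ := hc a b v' hv.1.1 hv.1.2
      refine ⟨v, ?_, rfl⟩
      simpa only [ptBox, Set.mem_ofPred_eq, hx, hy] using hv
    · rintro ⟨v, hv, rfl⟩
      simpa only [ptBox, Set.mem_ofPred_eq, hx, hy] using hv
  refine ⟨φ a, φ b, ?_, ?_, i, ?_⟩
  · rw [key, Set.ncard_image_of_injective _ hφ, hcard]
  · rw [key]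
    rintro _ ⟨u, hu, rfl⟩ _ ⟨v, hv, rfl⟩
    rw [hx, hy]
    exact hasc u hu v hv
  · rw [key]
    rintro _ ⟨u, hu, rfl⟩
    exact hi u hu

theorem GProp_zero (k : ℕ) : GProp k 0 := by
  refine ⟨Fin 1, inferInstance, inferInstance, inferInstance, fun i => i, Fin.val_injective, ?_⟩
  intro C hC χ hχ
  have : C = ∅ := by simpa using hC
  subst this
  exact absurd (hχ 0) (by simp)

theorem TProp_one {k c : ℕ} (h : GProp k c) : TProp k c 1 := by
  obtain ⟨W, hW, fW, nW, x, hx, H⟩ := h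
  obtain ⟨y, hy⟩ := exists_rank (fun w : W => w)
  refine ⟨W, W, fW, nW, hW, fW, x, y, fun w => w, hx, ?_, fun u v => (hy u v).1, ?_⟩
  · intro u v huv
    exact le_antisymm ((hy u v).1 huv.le) ((hy v u).1 huv.ge)
  intro C hC χ hχ i hi
  by_cases hex : ∃ w, χ w = i
  · obtain ⟨w, hw⟩ := hex
    right
    have : quadSet x y (fun w : W => w) w = {w} := by
      ext v
      simp only [quadSet, Set.mem_ofPred_eq, Set.mem_singleton_iff]
      constructor
      · exact fun h => h.1
      · rintro rfl
        simp
    refine ⟨w, ?_, ?_, ?_⟩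
    · rw [this]; simp
    · rw [this]
      rintro u rfl v rfl
      simp
    · rw [this]
      rintro u rfl
      exact hw
  · left
    push Not at hex
    have h1 := H (C.erase i) (by rw [Finset.card_erase_of_mem hi]; omega) χ
      (fun w => Finset.mem_erase.2 ⟨hex w, hχ w⟩)
    exact HasMono.transfer (fun w => w) Function.injective_id (fun _ _ => Iff.rfl) hy
      (fun _ _ v _ _ => ⟨v, rfl⟩) h1

theorem TProp_succ {k c m : ℕ} (h : GProp k c) (hT : TProp k c m) : TProp k c (m + 1) := by
  classical
  obtain ⟨W, hW, fW, nW, xW, hxW, H⟩ := h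
  obtain ⟨V, L, fV, nV, hL, fL, x, y, l, hx, hy, hl, HT⟩ := hT
  obtain ⟨N, ⟨eF⟩⟩ := Finite.exists_equiv_fin (L → W)
  obtain ⟨M, ⟨eL⟩⟩ := Finite.exists_equiv_fin L
  -- coordinates in lexicographic orders
  let kx : (L × W) ⊕ ((L → W) × V) → ℕ ×ₗ ℕ := fun p => match p with
    | Sum.inl q => toLex (N + (eL q.1 : ℕ), xW q.2)
    | Sum.inr q => toLex ((eF q.1 : ℕ), x q.2)
  let lev : (L × W) ⊕ ((L → W) × V) → L ×ₗ W := fun p => match p with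
    | Sum.inl q => toLex (q.1, q.2)
    | Sum.inr q => toLex (l q.2, q.1 (l q.2))
  let ky : (L × W) ⊕ ((L → W) × V) → (L ×ₗ W) ×ₗ (ℤ ×ₗ ℕ) := fun p => match p with
    | Sum.inl q => toLex (lev (Sum.inl q), toLex (1, 0))
    | Sum.inr q => toLex (lev (Sum.inr q), toLex (-((eF q.1 : ℕ) : ℤ), y q.2))
  have eFinj : ∀ f g : L → W, (eF f : ℕ) = eF g → f = g := fun f g h =>
    eF.injective (Fin.val_injective h)
  have eLinj : ∀ f g : L, (eL f : ℕ) = eL g → f = g := fun f g h =>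
    eL.injective (Fin.val_injective h)
  obtain ⟨x', hx'⟩ := exists_rank kx
  obtain ⟨y', hy'⟩ := exists_rank ky
  have kxinj : Function.Injective kx := by
    rintro (⟨j, w⟩ | ⟨f, v⟩) (⟨j', w'⟩ | ⟨f', v'⟩) h
    · have h1 := congrArg (fun t => (ofLex t).1) h
      have h2 := congrArg (fun t => (ofLex t).2) h
      simp only [kx, ofLex_toLex] at h1 h2
      rw [eLinj j j' (by omega), hxW h2]
    · have h1 := congrArg (fun t => (ofLex t).1) h
      simp only [kx, ofLex_toLex] at h1
      have := (eF f').2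
      omega
    · have h1 := congrArg (fun t => (ofLex t).1) h
      simp only [kx, ofLex_toLex] at h1
      have := (eF f).2
      omega
    · have h1 := congrArg (fun t => (ofLex t).1) h
      have h2 := congrArg (fun t => (ofLex t).2) h
      simp only [kx, ofLex_toLex] at h1 h2
      rw [eFinj f f' h1, hx h2]
  have kyinj : Function.Injective ky := by
    rintro (⟨j, w⟩ | ⟨f, v⟩) (⟨j', w'⟩ | ⟨f', v'⟩) h
    · have h1 := congrArg (fun t => ofLex (ofLex t).1) h
      simp only [ky, lev, ofLex_toLex] at h1
      rw [h1]
    · have h1 := congrArg (fun t => (ofLex (ofLex t).2).1) h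
      simp only [ky, ofLex_toLex] at h1
      omega
    · have h1 := congrArg (fun t => (ofLex (ofLex t).2).1) h
      simp only [ky, ofLex_toLex] at h1
      omega
    · have h1 := congrArg (fun t => (ofLex (ofLex t).2).1) h
      have h2 := congrArg (fun t => (ofLex (ofLex t).2).2) h
      simp only [ky, ofLex_toLex] at h1 h2
      rw [eFinj f f' (by omega), hy h2]
  have hkl : ∀ p, (ofLex (ky p)).1 = lev p := by
    rintro (q | q) <;> rfl
  -- transfer of monochromatic boxes
  have trW : ∀ (j : L) (χ : (L × W) ⊕ ((L → W) × V) → ℕ),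
      HasMono xW (fun w : W => w) k (fun w => χ (Sum.inl (j, w))) → HasMono x' y' k χ := by
    intro j χ h
    refine HasMono.transfer (fun w => Sum.inl (j, w)) ?_ ?_ ?_ ?_ h
    · intro a b hab
      simpa using hab
    · intro u v
      rw [hx']
      simp [kx, Prod.Lex.toLex_le_toLex]
    · intro u v
      rw [hy']
      simp [ky, lev, Prod.Lex.toLex_le_toLex, Prod.Lex.toLex_lt_toLex, le_iff_lt_or_eq]
    · rintro a b (⟨j', w⟩ | ⟨f, v⟩) h1 h2
      · rw [hx'] at h1 h2
        simp only [kx, Prod.Lex.toLex_le_toLex] at h1 h2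
        rw [eLinj j j' (by omega)]
        exact ⟨w, rfl⟩
      · rw [hx'] at h1 h2
        simp only [kx, Prod.Lex.toLex_le_toLex] at h1 h2
        have := (eF f).2
        omega
  have hxV : ∀ f u v, x' (Sum.inr (f, u)) ≤ x' (Sum.inr (f, v)) ↔ x u ≤ x v := by
    intro f u v
    rw [hx']
    simp [kx, Prod.Lex.toLex_le_toLex]
  have hyV : ∀ f u v, y' (Sum.inr (f, u)) ≤ y' (Sum.inr (f, v)) ↔ y u ≤ y v := by
    intro f u v
    rw [hy']
    simp only [ky, lev, Prod.Lex.toLex_le_toLex, Prod.Lex.toLex_lt_toLex]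
    constructor
    · rintro ((h | ⟨h, h'⟩) | ⟨h, h'⟩)
      · by_contra hlt
        exact absurd (hl v u (by omega)) (not_le.mpr h)
      · exact absurd h' (by rw [h]; exact lt_irrefl _)
      · simpa using h'
    · intro h
      rcases (hl u v h).lt_or_eq with h1 | h1
      · exact Or.inl (Or.inl h1)
      · right
        simp [h1, h]
  have trV : ∀ (f : L → W) (χ : (L × W) ⊕ ((L → W) × V) → ℕ),
      HasMono x y k (fun v => χ (Sum.inr (f, v))) → HasMono x' y' k χ := by
    intro f χ h
    refine HasMono.transfer (fun v => Sum.inr (f, v)) ?_ (hxV f) (hyV f) ?_ h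
    · intro a b hab
      simpa using hab
    · rintro a b (⟨j', w⟩ | ⟨g, v⟩) h1 h2
      · rw [hx'] at h1 h2
        simp only [kx, Prod.Lex.toLex_le_toLex] at h1 h2
        have := (eF f).2
        omega
      · rw [hx'] at h1 h2
        simp only [kx, Prod.Lex.toLex_le_toLex] at h1 h2
        rw [eFinj f g (by omega)]
        exact ⟨v, rfl⟩
  refine ⟨(L × W) ⊕ ((L → W) × V), L ×ₗ W, inferInstance, inferInstance, inferInstance,
    inferInstanceAs (Finite (L × W)), x', y', lev, ?_, ?_, ?_, ?_⟩
  · intro u v h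
    exact kxinj (le_antisymm ((hx' _ _).1 h.le) ((hx' _ _).1 h.ge))
  · intro u v h
    exact kyinj (le_antisymm ((hy' _ _).1 h.le) ((hy' _ _).1 h.ge))
  · intro u v h
    rw [← hkl, ← hkl]
    exact Prod.Lex.monotone_fst _ _ ((hy' _ _).1 h)
  intro C hC χ hχ i hi
  by_cases hm : HasMono x' y' k χ
  · exact Or.inl hm
  right
  have hex : ∀ j, ∃ w, χ (Sum.inl (j, w)) = i := by
    intro j
    by_contra hne
    push Not at hne
    exact hm (trW j χ (H (C.erase i) (by rw [Finset.card_erase_of_mem hi]; omega) _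
      (fun w => Finset.mem_erase.2 ⟨hne w, hχ _⟩)))
  choose f hf using hex
  rcases HT C hC (fun v => χ (Sum.inr (f, v))) (fun v => hχ _) i hi with h1 | ⟨a, hcard, hasc, hcol⟩
  · exact absurd (trV f χ h1) hm
  have key : quadSet x' y' lev (Sum.inr (f, a)) =
      insert (Sum.inl (l a, f (l a))) ((fun v => Sum.inr (f, v)) '' quadSet x y l a) := by
    ext p
    simp only [quadSet, Set.mem_ofPred_eq, Set.mem_insert_iff, Set.mem_image]
    rcases p with ⟨j, w⟩ | ⟨g, v⟩
    · constructor
      · rintro ⟨h1, -, -⟩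
        left
        have h1 := congrArg (fun t => ofLex t) h1
        simp only [lev, ofLex_toLex] at h1
        rw [h1]
      · rintro (h | ⟨v, -, h⟩)
        · rw [h]
          refine ⟨rfl, ?_, ?_⟩
          · rw [hx']
            simp only [kx, Prod.Lex.toLex_le_toLex]
            have := (eF f).2
            omega
          · rw [hy']
            simp only [ky, lev, Prod.Lex.toLex_le_toLex]
            right
            refine ⟨by trivial, Or.inl ?_⟩
            omega
        · simp at h
    · constructor
      · rintro ⟨h1, h2, h3⟩
        right
        rw [hx'] at h2
        rw [hy'] at h3
        have h4 := congrArg (fun t => (ofLex t).1) h1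
        simp only [lev, ofLex_toLex] at h4
        simp only [kx, Prod.Lex.toLex_le_toLex] at h2
        have h5 : lev (Sum.inr (f, a)) = lev (Sum.inr (g, v)) := h1.symm
        simp only [ky, Prod.Lex.toLex_le_toLex, h5, lt_irrefl, false_or, true_and] at h3
        have h6 : f = g := eFinj _ _ (by omega)
        subst h6
        exact ⟨v, ⟨h4, by omega, by omega⟩, rfl⟩
      · rintro (h | ⟨v', ⟨h1, h2, h3⟩, h⟩)
        · simp at h
        · simp only [Sum.inr.injEq, Prod.mk.injEq] at h
          obtain ⟨rfl, rfl⟩ := h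
          refine ⟨?_, (hxV _ _ _).2 h2, (hyV _ _ _).2 h3⟩
          simp only [lev, h1]
  refine ⟨Sum.inr (f, a), ?_, ?_, ?_⟩
  · rw [key, Set.ncard_insert_of_notMem (by simp) (Set.toFinite _), Set.ncard_image_of_injective,
      hcard]
    intro u v h
    simpa using h
  · rw [key]
    have hxt : ∀ v, x' (Sum.inr (f, v)) < x' (Sum.inl (l a, f (l a))) := by
      intro v
      rw [← not_le, hx']
      simp only [kx, Prod.Lex.toLex_le_toLex]
      have := (eF f).2
      omega
    have hyt : ∀ v, l v = l a → y' (Sum.inr (f, v)) < y' (Sum.inl (l a, f (l a))) := by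
      intro v hv
      rw [← not_le, hy']
      simp only [ky, lev, Prod.Lex.toLex_le_toLex, hv, lt_irrefl, false_or, true_and]
      omega
    rintro _ (rfl | ⟨u, hu, rfl⟩) _ (rfl | ⟨v, hv, rfl⟩)
    · simp
    · exact iff_of_false (not_le.2 (hxt v)) (not_le.2 (hyt v hv.1))
    · exact iff_of_true (hxt u).le (hyt u hu.1).le
    · simp only [hxV, hyV]
      exact hasc u hu v hv
  · rw [key]
    rintro _ (rfl | ⟨u, hu, rfl⟩)
    · exact hf _
    · exact hcol u hu

theorem GProp_succ {k c : ℕ} (h : TProp k c k) : GProp k (c + 1) := by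
  obtain ⟨V, L, fV, nV, hL, fL, x, y, l, hx, hy, hl, HT⟩ := h
  refine ⟨V, LinearOrder.lift' y hy, fV, nV, x, hx, ?_⟩
  intro C hC χ hχ
  suffices hs : HasMono x y k χ from hs
  obtain ⟨v0⟩ := nV
  rcases HT C hC χ hχ (χ v0) (hχ v0) with h | ⟨a, hcard, hasc, hcol⟩
  · exact h
  have ha : a ∈ quadSet x y l a := ⟨rfl, le_rfl, le_rfl⟩
  obtain ⟨b, hb, hmax⟩ := Set.exists_max_image (quadSet x y l a) y (Set.toFinite _) ⟨a, ha⟩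
  have key : ptBox x y a b = quadSet x y l a := by
    ext v
    constructor
    · rintro ⟨⟨h1, h2⟩, h3, h4⟩
      exact ⟨le_antisymm ((hl _ _ h4).trans hb.1.le) (hl _ _ h3), h1, h3⟩
    · intro hv
      exact ⟨⟨hv.2.1, (hasc v hv b hb).2 (hmax v hv)⟩, hv.2.2, hmax v hv⟩
  exact ⟨a, b, by rw [key, hcard], by rw [key]; exact hasc, χ v0, by rw [key]; exact hcol⟩

theorem GProp_all (k : ℕ) (hk : 0 < k) (c : ℕ) : GProp k c := by
  induction c with
  | zero => exact GProp_zero k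
  | succ c ih =>
    apply GProp_succ
    have : ∀ m, TProp k c (m + 1) := by
      intro m
      induction m with
      | zero => exact TProp_one ih
      | succ m ihm => exact TProp_succ ih ihm
    obtain ⟨m, rfl⟩ : ∃ m, k = m + 1 := ⟨k - 1, by omega⟩
    exact this m

/-- For any positive integers `c, k`, there exist a finite planar point set `P` and a
finite family `𝓡` of axis-parallel rectangles such that every `r ∈ 𝓡` contains exactly
`k` points of `P`, forming an ascending set, and every `c`-coloring of the plane leaves
`P ∩ r` monochromatic for some `r ∈ 𝓡`. -/
theorem statement15 (c k : ℕ) (hc : 0 < c) (hk : 0 < k) :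
    ∃ (P : Finset (ℝ × ℝ)) (𝓡 : Finset (ℝ × ℝ × ℝ × ℝ)),
      (∀ r ∈ 𝓡, r.1 ≤ r.2.1 ∧ r.2.2.1 ≤ r.2.2.2) ∧
      (∀ r ∈ 𝓡, ((P : Set (ℝ × ℝ)) ∩ rectSet r).ncard = k ∧
        Ascending ((P : Set (ℝ × ℝ)) ∩ rectSet r)) ∧
      ∀ χ : ℝ × ℝ → Fin c,
        ∃ r ∈ 𝓡, ∀ p ∈ (P : Set (ℝ × ℝ)) ∩ rectSet r,
          ∀ q ∈ (P : Set (ℝ × ℝ)) ∩ rectSet r, χ p = χ q := by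
  classical
  obtain ⟨W, hW, fW, nW, x, hx, H⟩ := GProp_all k hk c
  obtain ⟨y, hy⟩ := exists_rank (fun w : W => w)
  have hW' := Fintype.ofFinite W
  let p : W → ℝ × ℝ := fun w => ((x w : ℝ), (y w : ℝ))
  have hp : Function.Injective p := by
    intro u v h
    have h1 := congrArg Prod.fst h
    simp only [p] at h1
    exact hx (by exact_mod_cast h1)
  let rr : W × W → ℝ × ℝ × ℝ × ℝ := fun q => ((x q.1 : ℝ), (x q.2 : ℝ), (y q.1 : ℝ), (y q.2 : ℝ))
  have key : ∀ a b, ((Finset.univ.image p : Finset (ℝ × ℝ)) : Set (ℝ × ℝ)) ∩ rectSet (rr (a, b))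
      = p '' ptBox x (fun w : W => w) a b := by
    intro a b
    ext z
    simp only [Finset.coe_image, Finset.coe_univ, Set.image_univ, Set.mem_inter_iff,
      Set.mem_range, rectSet, Set.mem_prod, Set.mem_Icc, Set.mem_image, ptBox, Set.mem_ofPred_eq]
    constructor
    · rintro ⟨⟨w, rfl⟩, h⟩
      refine ⟨w, ?_, rfl⟩
      simpa [p, rr, hy] using h
    · rintro ⟨w, h, rfl⟩
      refine ⟨⟨w, rfl⟩, ?_⟩
      simpa [p, rr, hy] using h
  refine ⟨Finset.univ.image p, (Finset.univ.filter (fun q : W × W =>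
    (ptBox x (fun w : W => w) q.1 q.2).ncard = k ∧
      IdxAsc x (fun w : W => w) (ptBox x (fun w : W => w) q.1 q.2))).image rr, ?_, ?_, ?_⟩
  · intro r hr
    obtain ⟨⟨a, b⟩, hq, rfl⟩ := Finset.mem_image.1 hr
    obtain ⟨hcard, -⟩ := (Finset.mem_filter.1 hq).2
    obtain ⟨v, hv⟩ : (ptBox x (fun w : W => w) a b).Nonempty :=
      Set.nonempty_of_ncard_ne_zero (by simp only at hcard; omega)
    have h1 := hv.1.1.trans hv.1.2
    have h2 := (hy _ _).2 (hv.2.1.trans hv.2.2)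
    simp only [rr]
    exact ⟨by exact_mod_cast h1, by exact_mod_cast h2⟩
  · intro r hr
    obtain ⟨⟨a, b⟩, hq, rfl⟩ := Finset.mem_image.1 hr
    obtain ⟨hcard, hasc⟩ := (Finset.mem_filter.1 hq).2
    rw [key, Set.ncard_image_of_injective _ hp]
    refine ⟨hcard, ?_, ?_⟩
    · rintro _ ⟨u, hu, rfl⟩ _ ⟨v, hv, rfl⟩ h
      simp only [p] at h
      rw [hx (show x u = x v by exact_mod_cast h)]
    · rintro _ ⟨u, hu, rfl⟩ _ ⟨v, hv, rfl⟩
      have h1 := (hasc v hv u hu).trans (hy v u).symm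
      simp only [p, Nat.cast_lt]
      rw [← not_le, ← not_le, h1]
  · intro χ
    obtain ⟨a, b, hcard, hasc, i, hi⟩ := H (Finset.range c) (by simp) (fun w => (χ (p w) : ℕ))
      (fun w => Finset.mem_range.2 (χ (p w)).2)
    refine ⟨rr (a, b), Finset.mem_image.2 ⟨(a, b), Finset.mem_filter.2
      ⟨Finset.mem_univ _, hcard, hasc⟩, rfl⟩, ?_⟩
    rw [key]
    rintro _ ⟨u, hu, rfl⟩ _ ⟨v, hv, rfl⟩
    exact Fin.val_injective ((hi u hu).trans (hi v hv).symm)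
end
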